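/- arXiv:1701.07131 — 2 statements merged into one kernel-verified Lean document; each statement's English description precedes it below -/
import Mathlib

section
/- Let φ be a nontrivial classical solution of the linear parabolic equation φₜ = a(t,x) φₓₓ + b(t,x) φₓ + c(t,x) φ on (0,∞) × ℝ, 2π-periodic in x. Then the zero number is nonincreasing in time: for all 0 < t₁ ≤ t₂ one has z(φ(t₂,·)) ≤ z(φ(t₁,·)). -/
open Real Set Filter

noncomputable def zeroNum (u : ℝ → ℝ) : ℕ∞ :=
  {x ∈ Set.Ico (0 : ℝ) (2 * Real.pi) | u x = 0}.encard


noncomputable def gW (x : ℝ) : ℝ := Real.exp (-(1/4) * x^2)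

lemma gW_pos (x : ℝ) : 0 < gW x := Real.exp_pos _

lemma gW_cont : Continuous gW := by unfold gW; fun_prop

lemma gW_deriv (x : ℝ) : HasDerivAt gW (-(x/2) * gW x) x := by
  unfold gW
  have := ((hasDerivAt_pow 2 x).const_mul (-(1/4):ℝ)).exp
  convert this using 1
  simp; ring

lemma gW_int : MeasureTheory.Integrable (fun x => (1 + |x|)^2 * gW x) := by
  have h1 := (integrable_exp_neg_mul_sq (b := 1/4) (by norm_num)).const_mul 2
  have h2 := (integrable_rpow_mul_exp_neg_mul_sq (b := 1/4) (s := 2) (by norm_num) (by norm_num)).const_mul 2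
  refine (h1.add h2).mono' (by have := gW_cont; exact (by fun_prop : Continuous _).aestronglyMeasurable) ?_
  refine Filter.Eventually.of_forall fun x => ?_
  have hp := gW_pos x
  rw [Real.norm_of_nonneg (by positivity)]
  simp only [Pi.add_apply, Real.rpow_two]
  have : (1 + |x|)^2 ≤ 2 + 2 * x^2 := by nlinarith [sq_nonneg (1 - |x|), sq_abs x]
  calc _ ≤ (2 + 2 * x^2) * gW x := by gcongr
    _ = _ := by unfold gW; ring

def Gd (f : ℝ → ℝ) : Prop := Continuous f ∧ ∃ K, ∀ x, |f x| ≤ K * (1 + |x|)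

lemma Gd.of_bdd {f : ℝ → ℝ} (hf : Continuous f) {K : ℝ} (h : ∀ x, |f x| ≤ K) : Gd f := by
  refine ⟨hf, K, fun x => (h x).trans ?_⟩
  have := (abs_nonneg _).trans (h x)
  nlinarith [abs_nonneg x]

lemma Gd.add {f g : ℝ → ℝ} (hf : Gd f) (hg : Gd g) : Gd (fun x => f x + g x) := by
  obtain ⟨h1, K, hK⟩ := hf
  obtain ⟨h2, L, hL⟩ := hg
  refine ⟨h1.add h2, K + L, fun x => (abs_add_le _ _).trans ?_⟩
  linarith [hK x, hL x]

lemma Gd.smul {f : ℝ → ℝ} (hf : Gd f) (c : ℝ) : Gd (fun x => c * f x) := by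
  obtain ⟨h1, K, hK⟩ := hf
  refine ⟨h1.const_mul c, |c| * K, fun x => ?_⟩
  rw [abs_mul, mul_assoc]
  exact mul_le_mul_of_nonneg_left (hK x) (abs_nonneg _)

lemma Gd.integrable {f g : ℝ → ℝ} (hf : Gd f) (hg : Gd g) :
    MeasureTheory.Integrable (fun x => f x * g x * gW x) := by
  obtain ⟨h1, K, hK⟩ := hf
  obtain ⟨h2, L, hL⟩ := hg
  refine (gW_int.const_mul (K * L)).mono' (by have := gW_cont; exact (by fun_prop : Continuous _).aestronglyMeasurable) ?_
  refine Filter.Eventually.of_forall fun x => ?_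
  have hp := gW_pos x
  rw [Real.norm_eq_abs, abs_mul, abs_mul, abs_of_pos hp]
  calc _ ≤ (K * (1 + |x|)) * (L * (1 + |x|)) * gW x := by
        gcongr
        · exact (abs_nonneg _).trans (hK x)
        · exact hK x
        · exact hL x
    _ = _ := by ring

noncomputable def ip (f g : ℝ → ℝ) : ℝ := ∫ x, f x * g x * gW x

lemma ip_comm (f g : ℝ → ℝ) : ip f g = ip g f := by
  unfold ip; congr 1; ext x; ring

lemma ip_add {f g h : ℝ → ℝ} (hf : Gd f) (hg : Gd g) (hh : Gd h) :
    ip f (fun x => g x + h x) = ip f g + ip f h := by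
  unfold ip
  rw [← MeasureTheory.integral_add (hf.integrable hg) (hf.integrable hh)]
  congr 1; ext x; ring

lemma ip_smul (f g : ℝ → ℝ) (c : ℝ) :
    ip f (fun x => c * g x) = c * ip f g := by
  unfold ip
  rw [← MeasureTheory.integral_const_mul]
  congr 1; ext x; ring

lemma ip_self_nonneg (f : ℝ → ℝ) : 0 ≤ ip f f := by
  unfold ip
  refine MeasureTheory.integral_nonneg fun x => ?_
  exact mul_nonneg (mul_self_nonneg _) (gW_pos x).le

lemma ip_mono {f g h k : ℝ → ℝ} (hf : Gd f) (hg : Gd g) (hh : Gd h) (hk : Gd k)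
    (H : ∀ x, f x * g x ≤ h x * k x) : ip f g ≤ ip h k := by
  unfold ip
  refine MeasureTheory.integral_mono (hf.integrable hg) (hh.integrable hk) fun x => ?_
  exact mul_le_mul_of_nonneg_right (H x) (gW_pos x).le

/-- integration by parts -/
lemma ip_parts {f f' p p' : ℝ → ℝ} (hf : ∀ x, HasDerivAt f (f' x) x) (hp : ∀ x, HasDerivAt p (p' x) x)
    (hf' : Continuous f') (hp' : Continuous p') {K : ℝ}
    (bf : ∀ x, |f x| ≤ K) (bf' : ∀ x, |f' x| ≤ K) (bp : ∀ x, |p x| ≤ K) (bp' : ∀ x, |p' x| ≤ K) :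
    Gd (fun x => p' x - x/2 * p x) ∧ 
    ip f (fun x => p' x - x/2 * p x) = - ip f' p := by
  have cf : Continuous f := continuous_iff_continuousAt.2 fun x => (hf x).continuousAt
  have cp : Continuous p := continuous_iff_continuousAt.2 fun x => (hp x).continuousAt
  have gf := Gd.of_bdd cf bf
  have gf' := Gd.of_bdd hf' bf'
  have gp := Gd.of_bdd cp bp
  have gA : Gd (fun x => p' x - x/2 * p x) := by
    refine ⟨by fun_prop, K, fun x => ?_⟩
    have h1 := abs_sub (p' x) (x/2 * p x)
    rw [abs_mul, abs_div, abs_two] at h1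
    have := bp x
    have := bp' x
    have := abs_nonneg x
    nlinarith [abs_nonneg (p x), abs_nonneg (p' x)]
  refine ⟨gA, ?_⟩
  have key : ∫ x, (f x * (p' x - x/2 * p x) * gW x + f' x * p x * gW x) = 0 := by
    refine MeasureTheory.integral_eq_zero_of_hasDerivAt_of_integrable (f := fun x => f x * p x * gW x) (fun x => ?_) ?_ (gf.integrable gp)
    · have := ((hf x).mul (hp x)).mul (gW_deriv x)
      refine this.congr_deriv ?_
      simp only [Pi.mul_apply]
      ring
    · exact (gf.integrable gA).add (gf'.integrable gp)
  rw [MeasureTheory.integral_add (gf.integrable gA) (gf'.integrable gp)] at key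
  unfold ip
  linarith

/-- algebraic frequency inequality -/
lemma freq_alg {v A F : ℝ → ℝ} (gv : Gd v) (gA : Gd A) (gF : Gd F) {β D : ℝ} (hβ : 0 < β)
    (hq : ip v A = - D) (hH : 0 < ip v v) :
    (-2 * ip (fun x => β * A x + F x) A) * ip v v - D * (2 * ip v (fun x => β * A x + F x))
      ≤ ip v v * (ip F F / (2 * β)) := by
  set κ : ℝ := (ip v A + ip v F / (2 * β)) / ip v v with hκ
  have gP : Gd (fun x => A x + ((1/(2*β)) * F x + (-κ) * v x)) := gA.add ((gF.smul _).add (gv.smul _))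
  have g1 := (gF.smul (1/(2*β))).add (gv.smul (-κ))
  have h0 := ip_self_nonneg (fun x => A x + ((1/(2*β)) * F x + (-κ) * v x))
  have e1 : ∀ f, Gd f → ip f (fun x => A x + ((1/(2*β)) * F x + (-κ) * v x)) = ip f A + ((1/(2*β)) * ip f F + (-κ) * ip f v) := by
    intro f gf
    rw [ip_add gf gA g1, ip_add gf (gF.smul _) (gv.smul _), ip_smul, ip_smul]
  rw [e1 _ gP, ip_comm _ A, ip_comm _ F, ip_comm _ v, e1 _ gA, e1 _ gF, e1 _ gv, ip_comm F A, ip_comm A v, ip_comm F v] at h0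
  rw [ip_add gv (gA.smul _) gF, ip_smul, ip_comm _ A, ip_add gA (gA.smul _) gF, ip_smul]
  have hk : κ * ip v v = ip v A + ip v F / (2 * β) := by rw [hκ]; field_simp
  rw [hq] at hk h0 ⊢
  generalize ip v v = H at *
  generalize ip v F = X at *
  generalize ip A F = Y at *
  generalize ip A A = P at *
  generalize ip F F = S at *
  have h2 : 0 ≤ 2 * β * H * (P + S/(4*β^2) + Y/β) - 2 * β * (κ * H)^2 := by
    have := mul_nonneg (by positivity : 0 ≤ 2 * β * H) h0
    have hD : D = X / (2 * β) - κ * H := by linarith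
    refine this.trans (le_of_eq ?_)
    rw [hD]
    field_simp
    ring
  rw [hk] at h2
  have h3 : 2 * β * H * (P + S/(4*β^2) + Y/β) - 2 * β * (-D + X/(2*β))^2 = H * (S/(2*β)) + 2 * β * P * H + 2 * Y * H - 2 * β * D^2 + 2 * D * X - X^2/(2*β) := by
    field_simp; ring
  have : 0 ≤ X^2/(2*β) := by positivity
  nlinarith


structure OU (v vt v1 v2 : ℝ → ℝ → ℝ) (t0 η K : ℝ) : Prop where
  hη : 0 < η
  ht : ∀ t ∈ Metric.ball t0 η, ∀ x, HasDerivAt (fun s => v s x) (vt t x) t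
  hx : ∀ t ∈ Metric.ball t0 η, ∀ x, HasDerivAt (v t) (v1 t x) x
  hxx : ∀ t ∈ Metric.ball t0 η, ∀ x, HasDerivAt (v1 t) (v2 t x) x
  b0 : ∀ t ∈ Metric.ball t0 η, ∀ x, |v t x| ≤ K
  b1 : ∀ t ∈ Metric.ball t0 η, ∀ x, |v1 t x| ≤ K
  b2 : ∀ t ∈ Metric.ball t0 η, ∀ x, |v2 t x| ≤ K
  bt : ∀ t ∈ Metric.ball t0 η, ∀ x, |vt t x| ≤ K * (1 + |x|)
  ct : ∀ t ∈ Metric.ball t0 η, Continuous (vt t)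
  c2 : ∀ t ∈ Metric.ball t0 η, Continuous (v2 t)
  k1 : ∀ x, ContinuousAt (fun t => v1 t x) t0
  k2 : ∀ x, ContinuousAt (fun t => v2 t x) t0

section
variable {v vt v1 v2 : ℝ → ℝ → ℝ} {t0 η K : ℝ}

lemma OU.mem (h : OU v vt v1 v2 t0 η K) : t0 ∈ Metric.ball t0 η := Metric.mem_ball_self h.hη

lemma OU.c0 (h : OU v vt v1 v2 t0 η K) {t : ℝ} (ht : t ∈ Metric.ball t0 η) : Continuous (v t) :=
  continuous_iff_continuousAt.2 fun x => (h.hx t ht x).continuousAt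

lemma OU.c1 (h : OU v vt v1 v2 t0 η K) {t : ℝ} (ht : t ∈ Metric.ball t0 η) : Continuous (v1 t) :=
  continuous_iff_continuousAt.2 fun x => (h.hxx t ht x).continuousAt

lemma OU.K_nonneg (h : OU v vt v1 v2 t0 η K) : 0 ≤ K := (abs_nonneg _).trans (h.b0 t0 h.mem 0)

lemma OU.g0 (h : OU v vt v1 v2 t0 η K) {t : ℝ} (ht : t ∈ Metric.ball t0 η) : Gd (v t) :=
  Gd.of_bdd (h.c0 ht) (h.b0 t ht)

lemma OU.g1 (h : OU v vt v1 v2 t0 η K) {t : ℝ} (ht : t ∈ Metric.ball t0 η) : Gd (v1 t) :=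
  Gd.of_bdd (h.c1 ht) (h.b1 t ht)

lemma OU.gt (h : OU v vt v1 v2 t0 η K) {t : ℝ} (ht : t ∈ Metric.ball t0 η) : Gd (vt t) :=
  ⟨h.ct t ht, K, h.bt t ht⟩

lemma OU.gA (h : OU v vt v1 v2 t0 η K) {t : ℝ} (ht : t ∈ Metric.ball t0 η) :
    Gd (fun x => v2 t x - x/2 * v1 t x) :=
  (ip_parts (h.hx t ht) (h.hxx t ht) (h.c1 ht) (h.c2 t ht) (h.b0 t ht) (h.b1 t ht) (h.b1 t ht) (h.b2 t ht)).1

lemma OU.ipA (h : OU v vt v1 v2 t0 η K) {t : ℝ} (ht : t ∈ Metric.ball t0 η) :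
    ip (v t) (fun x => v2 t x - x/2 * v1 t x) = - ip (v1 t) (v1 t) :=
  (ip_parts (h.hx t ht) (h.hxx t ht) (h.c1 ht) (h.c2 t ht) (h.b0 t ht) (h.b1 t ht) (h.b1 t ht) (h.b2 t ht)).2

lemma OU.lip (h : OU v vt v1 v2 t0 η K) {t : ℝ} (ht : t ∈ Metric.ball t0 η) (x : ℝ) :
    |v t x - v t0 x| ≤ K * (1 + |x|) * |t - t0| := by
  have := Convex.norm_image_sub_le_of_norm_hasDerivWithin_le (f := fun s => v s x) (f' := fun s => vt s x)
    (C := K * (1 + |x|)) (s := Metric.ball t0 η)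
    (fun s hs => (h.ht s hs x).hasDerivWithinAt) (fun s hs => h.bt s hs x) (convex_ball t0 η) h.mem ht
  simpa using this

lemma OU.Hderiv (h : OU v vt v1 v2 t0 η K) :
    HasDerivAt (fun t => ip (v t) (v t)) (2 * ip (v t0) (vt t0)) t0 := by
  have hb : Metric.ball t0 η ∈ nhds t0 := Metric.ball_mem_nhds _ h.hη
  have hg := gW_cont
  have := (hasDerivAt_integral_of_dominated_loc_of_deriv_le (μ := MeasureTheory.volume)
    (F := fun t x => v t x * v t x * gW x) (F' := fun t x => (vt t x * v t x + v t x * vt t x) * gW x)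
    (x₀ := t0) (s := Metric.ball t0 η) (bound := fun x => (2 * K * K) * ((1 + |x|)^2 * gW x)) hb ?_ ((h.g0 h.mem).integrable (h.g0 h.mem)) ?_ ?_ (gW_int.const_mul _) ?_).2
  · unfold ip
    refine this.congr_deriv ?_
    rw [← MeasureTheory.integral_const_mul]
    congr 1; ext x; ring
  · filter_upwards [hb] with t ht
    exact ((h.g0 ht).integrable (h.g0 ht)).aestronglyMeasurable
  · have := h.c0 h.mem
    have := h.ct t0 h.mem
    exact (by fun_prop : Continuous _).aestronglyMeasurable
  · refine Eventually.of_forall fun x t ht => ?_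
    have hp := gW_pos x
    rw [norm_mul, Real.norm_eq_abs, Real.norm_eq_abs, abs_of_pos hp, ← mul_assoc]
    gcongr
    have e1 := h.b0 t ht x
    have e2 := h.bt t ht x
    have hK := h.K_nonneg
    have hx := abs_nonneg x
    have e3 : |v t x| * |vt t x| ≤ K * (K * (1 + |x|)) := by gcongr
    have e4 : |vt t x * v t x + v t x * vt t x| = 2 * (|v t x| * |vt t x|) := by
      rw [← abs_mul, show vt t x * v t x + v t x * vt t x = 2 * (v t x * vt t x) by ring, abs_mul, abs_two]
    rw [e4]
    have : 0 ≤ K * K * (1 + |x|) * |x| := by positivity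
    nlinarith
  · refine Eventually.of_forall fun x t ht => ?_
    exact ((h.ht t ht x).mul (h.ht t ht x)).mul_const (gW x)

lemma OU.Dderiv (h : OU v vt v1 v2 t0 η K) :
    HasDerivAt (fun t => ip (v1 t) (v1 t)) (-2 * ip (vt t0) (fun x => v2 t0 x - x/2 * v1 t0 x)) t0 := by
  have hb : Metric.ball t0 η ∈ nhds t0 := Metric.ball_mem_nhds _ h.hη
  have hb' : ∀ᶠ t in nhdsWithin t0 {t0}ᶜ, t ∈ Metric.ball t0 η := nhdsWithin_le_nhds hb
  have hg := gW_cont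
  rw [hasDerivAt_iff_tendsto_slope]
  have key : ∀ t ∈ Metric.ball t0 η, slope (fun t => ip (v1 t) (v1 t)) t0 t =
      ∫ x, - ((t - t0)⁻¹ * (v t x - v t0 x)) * ((v2 t x + v2 t0 x) - x/2 * (v1 t x + v1 t0 x)) * gW x := by
    intro t ht
    have hp := (ip_parts (f := fun x => v t x - v t0 x) (f' := fun x => v1 t x - v1 t0 x)
      (p := fun x => v1 t x + v1 t0 x) (p' := fun x => v2 t x + v2 t0 x) (K := 2 * K)
      (fun x => (h.hx t ht x).sub (h.hx t0 h.mem x)) (fun x => (h.hxx t ht x).add (h.hxx t0 h.mem x))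
      ((h.c1 ht).sub (h.c1 h.mem)) ((h.c2 t ht).add (h.c2 t0 h.mem)) 
      (fun x => (abs_sub _ _).trans (by linarith [h.b0 t ht x, h.b0 t0 h.mem x]))
      (fun x => (abs_sub _ _).trans (by linarith [h.b1 t ht x, h.b1 t0 h.mem x]))
      (fun x => (abs_add_le _ _).trans (by linarith [h.b1 t ht x, h.b1 t0 h.mem x]))
      (fun x => (abs_add_le _ _).trans (by linarith [h.b2 t ht x, h.b2 t0 h.mem x]))).2
    have e : ip (v1 t) (v1 t) - ip (v1 t0) (v1 t0) = ip (fun x => v1 t x - v1 t0 x) (fun x => v1 t x + v1 t0 x) := by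
      unfold ip
      rw [← MeasureTheory.integral_sub ((h.g1 ht).integrable (h.g1 ht)) ((h.g1 h.mem).integrable (h.g1 h.mem))]
      congr 1; ext x; ring
    rw [slope_def_module, smul_eq_mul, e, ← neg_neg (ip (fun x => v1 t x - v1 t0 x) _), ← hp]
    unfold ip
    rw [← MeasureTheory.integral_neg, ← MeasureTheory.integral_const_mul]
    congr 1; ext x; ring
  refine Tendsto.congr' (hb'.mono fun t ht => (key t ht).symm) ?_
  have e : -2 * ip (vt t0) (fun x => v2 t0 x - x/2 * v1 t0 x) =
      ∫ x, - vt t0 x * ((v2 t0 x + v2 t0 x) - x/2 * (v1 t0 x + v1 t0 x)) * gW x := by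
    unfold ip
    rw [← MeasureTheory.integral_const_mul]
    congr 1; ext x; ring
  rw [e]
  refine MeasureTheory.tendsto_integral_filter_of_dominated_convergence
    (fun x => (2 * K * K) * ((1 + |x|)^2 * gW x)) ?_ ?_ (gW_int.const_mul _) ?_
  · filter_upwards [hb'] with t ht
    have := h.c0 h.mem
    have := h.c0 ht
    have := h.c1 h.mem
    have := h.c1 ht
    have := h.c2 _ h.mem
    have := h.c2 _ ht
    exact (by fun_prop : Continuous _).aestronglyMeasurable
  · filter_upwards [hb', self_mem_nhdsWithin] with t ht hne
    refine Eventually.of_forall fun x => ?_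
    have hp := gW_pos x
    have hK := h.K_nonneg
    rw [norm_mul, norm_mul, norm_neg, norm_mul]
    simp only [Real.norm_eq_abs]
    rw [abs_of_pos hp, abs_inv]
    have hpos : 0 < |t - t0| := abs_pos.2 (sub_ne_zero.2 hne)
    have h1 : |t - t0|⁻¹ * |v t x - v t0 x| ≤ K * (1 + |x|) := by
      rw [inv_mul_le_iff₀ hpos]
      linarith [h.lip ht x]
    have h2 : |v2 t x + v2 t0 x - x / 2 * (v1 t x + v1 t0 x)| ≤ 2 * K * (1 + |x|) := by
      have e1 := abs_sub (v2 t x + v2 t0 x) (x / 2 * (v1 t x + v1 t0 x))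
      have e2 := abs_add_le (v2 t x) (v2 t0 x)
      have e3 := abs_add_le (v1 t x) (v1 t0 x)
      rw [abs_mul, abs_div, abs_two] at e1
      have e4 : |x|/2 * |v1 t x + v1 t0 x| ≤ |x|/2 * (2 * K) := by
        gcongr
        linarith [h.b1 t ht x, h.b1 t0 h.mem x]
      nlinarith [h.b2 t ht x, h.b2 t0 h.mem x, abs_nonneg x]
    calc _ ≤ (K * (1 + |x|)) * (2 * K * (1 + |x|)) * gW x := by gcongr
      _ = _ := by ring
  · refine Eventually.of_forall fun x => ?_
    have h1 := (hasDerivAt_iff_tendsto_slope.1 (h.ht t0 h.mem x))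
    simp only [slope_fun_def, smul_eq_mul, vsub_eq_sub] at h1
    have h2 : Tendsto (fun t => v2 t x) (nhdsWithin t0 {t0}ᶜ) (nhds (v2 t0 x)) :=
      (h.k2 x).tendsto.mono_left nhdsWithin_le_nhds
    have h3 : Tendsto (fun t => v1 t x) (nhdsWithin t0 {t0}ᶜ) (nhds (v1 t0 x)) :=
      (h.k1 x).tendsto.mono_left nhdsWithin_le_nhds
    exact (h1.neg.mul ((h2.add_const _).sub ((h3.add_const _).const_mul _))).mul_const _

end


structure WS (w wt wz wzz : ℝ → ℝ → ℝ) : Prop where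
  c0 : Continuous (fun p : ℝ × ℝ => w p.1 p.2)
  ct : Continuous (fun p : ℝ × ℝ => wt p.1 p.2)
  c1 : Continuous (fun p : ℝ × ℝ => wz p.1 p.2)
  c2 : Continuous (fun p : ℝ × ℝ => wzz p.1 p.2)
  ht : ∀ t x, HasDerivAt (fun s => w s x) (wt t x) t
  hx : ∀ t x, HasDerivAt (w t) (wz t x) x
  hxx : ∀ t x, HasDerivAt (wz t) (wzz t x) x

/-- chain rule along a curve -/
lemma chain2 {f ft fx : ℝ → ℝ → ℝ} (ct : Continuous (fun p : ℝ × ℝ => ft p.1 p.2))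
    (cx : Continuous (fun p : ℝ × ℝ => fx p.1 p.2))
    (ht : ∀ t x, HasDerivAt (fun s => f s x) (ft t x) t)
    (hx : ∀ t x, HasDerivAt (f t) (fx t x) x) {X : ℝ → ℝ} {X' t : ℝ} (hX : HasDerivAt X X' t) :
    HasDerivAt (fun s => f s (X s)) (ft t (X t) + fx t (X t) * X') t := by
  have h := hasStrictFDerivAt_uncurry_coprod (𝕜 := ℝ) (u := (t, X t)) (f := f)
    (f₁ := fun t x => ContinuousLinearMap.toSpanSingleton ℝ (ft t x))
    (f₂ := fun t x => ContinuousLinearMap.toSpanSingleton ℝ (fx t x))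
    (Eventually.of_forall fun p => (ht p.1 p.2).hasFDerivAt)
    (Eventually.of_forall fun p => (hx p.1 p.2).hasFDerivAt)
    (by
      have : Continuous (fun p : ℝ × ℝ => ContinuousLinearMap.toSpanSingleton ℝ (ft p.1 p.2)) :=
        (ContinuousLinearMap.toSpanSingletonLIE ℝ ℝ).continuous.comp ct
      exact this.continuousAt)
    (by
      have : Continuous (fun p : ℝ × ℝ => ContinuousLinearMap.toSpanSingleton ℝ (fx p.1 p.2)) :=
        (ContinuousLinearMap.toSpanSingletonLIE ℝ ℝ).continuous.comp cx
      exact this.continuousAt)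
  have h2 := h.hasFDerivAt.comp_hasDerivAt t ((hasDerivAt_id t).prodMk hX)
  refine h2.congr_deriv ?_
  simp [Function.HasUncurry.uncurry]
  ring

lemma WS.ou {w wt wz wzz : ℝ → ℝ → ℝ} (h : WS w wt wz wzz) {s0 T K : ℝ}
    (bd : ∀ t ∈ Icc (s0-1) (T+1), ∀ x, |w t x| ≤ K ∧ |wt t x| ≤ K ∧ |wz t x| ≤ K ∧ |wzz t x| ≤ K)
    {t0 : ℝ} (ht0 : t0 ∈ Icc s0 T) {σ σ' : ℝ → ℝ} (hσ : ∀ᶠ t in nhds t0, HasDerivAt σ (σ' t) t)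
    (cσ' : ContinuousAt σ' t0) :
    ∃ η L, OU (fun t x => w t (σ t * x)) (fun t x => wt t (σ t * x) + wz t (σ t * x) * (σ' t * x))
      (fun t x => wz t (σ t * x) * σ t) (fun t x => wzz t (σ t * x) * σ t * σ t) t0 η L := by
  have cσ : ContinuousAt σ t0 := hσ.self_of_nhds.continuousAt
  set S := |σ t0| + |σ' t0| + 1 with hS
  have e1 : ∀ᶠ t in nhds t0, |σ t| < S := by
    have := cσ.abs.tendsto
    exact this.eventually (gt_mem_nhds (by have := abs_nonneg (σ' t0); linarith))
  have e2 : ∀ᶠ t in nhds t0, |σ' t| < S := by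
    have := cσ'.abs.tendsto
    exact this.eventually (gt_mem_nhds (by have := abs_nonneg (σ t0); linarith))
  have e3 : ∀ᶠ t in nhds t0, t ∈ Icc (s0-1) (T+1) :=
    Icc_mem_nhds (by linarith [ht0.1]) (by linarith [ht0.2])
  obtain ⟨η, hη, H⟩ := Metric.eventually_nhds_iff_ball.1 (hσ.and (e1.and (e2.and e3)))
  have hK : 0 ≤ K := (abs_nonneg _).trans (bd t0 ⟨by linarith [ht0.1], by linarith [ht0.2]⟩ 0).1
  have hS1 : 1 ≤ S := by have := abs_nonneg (σ t0); have := abs_nonneg (σ' t0); linarith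
  have c0 := h.c0
  have c1 := h.c1
  have c2 := h.c2
  have ct := h.ct
  refine ⟨η, K * S * S, ⟨hη, ?_, ?_, ?_, ?_, ?_, ?_, ?_, ?_, ?_, ?_, ?_⟩⟩
  · intro t ht x
    exact chain2 h.ct h.c1 h.ht h.hx ((H t ht).1.mul_const x)
  · intro t ht x
    have := (h.hx t (σ t * x)).comp x ((hasDerivAt_id x).const_mul (σ t))
    exact this.congr_deriv (by simp)
  · intro t ht x
    have := ((h.hxx t (σ t * x)).comp x ((hasDerivAt_id x).const_mul (σ t))).mul_const (σ t)
    simpa using this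
  · intro t ht x
    have := (bd t (H t ht).2.2.2 (σ t * x)).1
    nlinarith [mul_nonneg hK (by linarith : 0 ≤ S - 1), mul_nonneg hK (by nlinarith : 0 ≤ S * S - 1)]
  · intro t ht x
    have h1 := (bd t (H t ht).2.2.2 (σ t * x)).2.2.1
    have h2 := (H t ht).2.1.le
    rw [abs_mul]
    calc _ ≤ K * S := by gcongr
      _ ≤ K * S * S := by nlinarith [mul_nonneg hK (by linarith : 0 ≤ S)]
  · intro t ht x
    have h1 := (bd t (H t ht).2.2.2 (σ t * x)).2.2.2
    have h2 := (H t ht).2.1.le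
    rw [abs_mul, abs_mul]
    gcongr
  · intro t ht x
    have h1 := (bd t (H t ht).2.2.2 (σ t * x)).2.1
    have h2 := (bd t (H t ht).2.2.2 (σ t * x)).2.2.1
    have h3 := (H t ht).2.2.1.le
    have h4 := abs_add_le (wt t (σ t * x)) (wz t (σ t * x) * (σ' t * x))
    rw [abs_mul, abs_mul] at h4
    have h5 : |wz t (σ t * x)| * (|σ' t| * |x|) ≤ K * (S * |x|) := by gcongr
    have h6 : K ≤ K * S * S := by
      nlinarith [mul_nonneg hK (by nlinarith : 0 ≤ S * S - 1)]
    have h7 : K * (S * |x|) ≤ K * S * S * |x| := by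
      nlinarith [mul_nonneg (mul_nonneg hK (abs_nonneg x)) (by nlinarith : 0 ≤ S * S - S)]
    linarith
  · intro t ht
    have := c1.comp (by fun_prop : Continuous (fun x : ℝ => (t, σ t * x)))
    have := ct.comp (by fun_prop : Continuous (fun x : ℝ => (t, σ t * x)))
    simp only [Function.comp_def] at *
    fun_prop
  · intro t ht
    have := c2.comp (by fun_prop : Continuous (fun x : ℝ => (t, σ t * x)))
    simp only [Function.comp_def] at *
    fun_prop
  · intro x
    have := c1.continuousAt.comp (continuousAt_id.prodMk (cσ.mul_const x))
    exact this.mul cσ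
  · intro x
    have := c2.continuousAt.comp (continuousAt_id.prodMk (cσ.mul_const x))
    exact (this.mul cσ).mul cσ


noncomputable def HH (w : ℝ → ℝ → ℝ) (τ : ℝ → ℝ) (t : ℝ) : ℝ :=
  ip (fun x => w t (√(τ t) * x)) (fun x => w t (√(τ t) * x))
noncomputable def DD (wz : ℝ → ℝ → ℝ) (τ : ℝ → ℝ) (t : ℝ) : ℝ :=
  ip (fun x => wz t (√(τ t) * x) * √(τ t)) (fun x => wz t (√(τ t) * x) * √(τ t))

lemma ip_self_pos {f : ℝ → ℝ} (gf : Gd f) {x0 : ℝ} (h : f x0 ≠ 0) : 0 < ip f f := by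
  unfold ip
  have hg := gW_cont
  have hc := gf.1
  refine MeasureTheory.integral_pos_of_integrable_nonneg_nonzero (x := x0) (by fun_prop) (gf.integrable gf) ?_ ?_
  · intro x
    exact mul_nonneg (mul_self_nonneg _) (gW_pos x).le
  · exact mul_ne_zero (mul_ne_zero h h) (gW_pos x0).ne'

lemma WS.pt {w wt wz wzz : ℝ → ℝ → ℝ} (h : WS w wt wz wzz) {s0 T K : ℝ}
    (bd : ∀ t ∈ Icc (s0-1) (T+1), ∀ x, |w t x| ≤ K ∧ |wt t x| ≤ K ∧ |wz t x| ≤ K ∧ |wzz t x| ≤ K)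
    {α τ : ℝ → ℝ} (cα : Continuous α) (hτ : ∀ t, HasDerivAt τ (-α t) t) {M : ℝ}
    {t : ℝ} (ht : t ∈ Icc s0 T) (hα : 0 < α t) (hτp : 0 < τ t) (hM : 0 ≤ M)
    (heq : ∀ x, |wt t x - α t * wzz t x| ≤ M * (|w t x| + |wz t x|)) 
    (hne : ∃ x, w t x ≠ 0) : 
    ∃ Hd Dd, HasDerivAt (HH w τ) Hd t ∧ HasDerivAt (DD wz τ) Dd t ∧ 0 < HH w τ t ∧ 0 ≤ DD wz τ t ∧
      Dd * HH w τ t - DD wz τ t * Hd ≤ HH w τ t * (M^2 / α t * (τ t * HH w τ t + DD wz τ t)) ∧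
      -((2 * α t + 1) / τ t * DD wz τ t + (2 * M + M^2) * HH w τ t) ≤ Hd := by
  have cτ : Continuous τ := continuous_iff_continuousAt.2 fun x => (hτ x).continuousAt
  have hs : 0 < √(τ t) := Real.sqrt_pos.2 hτp
  have hss : √(τ t) * √(τ t) = τ t := Real.mul_self_sqrt hτp.le
  obtain ⟨η, L, ou⟩ := h.ou bd ht (σ := fun t => √(τ t)) (σ' := fun t => -α t / (2 * √(τ t)))
    (by
      filter_upwards [cτ.continuousAt.eventually (lt_mem_nhds hτp)] with s hs
      exact (hτ s).sqrt hs.ne')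
    (by
      refine ContinuousAt.div (by fun_prop) (by fun_prop) (by positivity))
  set v : ℝ → ℝ := fun x => w t (√(τ t) * x) with hv
  set v1 : ℝ → ℝ := fun x => wz t (√(τ t) * x) * √(τ t) with hv1
  set A : ℝ → ℝ := fun x => wzz t (√(τ t) * x) * √(τ t) * √(τ t) - x/2 * (wz t (√(τ t) * x) * √(τ t)) with hA
  set F : ℝ → ℝ := fun x => wt t (√(τ t) * x) - α t * wzz t (√(τ t) * x) with hF
  set β := α t / τ t with hβ
  have hβp : 0 < β := by positivity
  have gv : Gd v := ou.g0 ou.mem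
  have gv1 : Gd v1 := ou.g1 ou.mem
  have gA : Gd A := ou.gA ou.mem
  have gvt := ou.gt ou.mem
  have evt : (fun x => wt t (√(τ t) * x) + wz t (√(τ t) * x) * (-α t / (2 * √(τ t)) * x)) = fun x => β * A x + F x := by
    ext x
    have hb2 : β = α t / (√(τ t) * √(τ t)) := by rw [hss]
    simp only [hA, hF]
    rw [hb2]
    field_simp
    ring
  have gF : Gd F := by
    have := gvt.add (gA.smul (-β))
    have e : F = fun x => (wt t (√(τ t) * x) + wz t (√(τ t) * x) * (-α t / (2 * √(τ t)) * x)) + -β * A x := by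
      ext x
      have := congrFun evt x
      rw [this]; ring
    rw [e]; exact this
  have d1 := ou.Hderiv
  have d2 := ou.Dderiv
  rw [evt] at d1 d2
  have hHp : 0 < HH w τ t := by
    obtain ⟨x, hx⟩ := hne
    refine ip_self_pos gv (x0 := (√(τ t))⁻¹ * x) ?_
    change w t (√(τ t) * ((√(τ t))⁻¹ * x)) ≠ 0
    rwa [mul_inv_cancel_left₀ hs.ne']
  have eH : HH w τ t = ip v v := rfl
  have eD : DD wz τ t = ip v1 v1 := rfl
  refine ⟨_, _, d1, d2, hHp, ip_self_nonneg _, ?_, ?_⟩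
  · have key := freq_alg gv gA gF hβp (ou.ipA ou.mem) hHp
    rw [eH, eD]
    refine key.trans ?_
    rw [eH] at hHp
    refine mul_le_mul_of_nonneg_left ?_ hHp.le
    have hFF : ip F F ≤ 2 * M^2 * (ip v v + ip v1 v1 / τ t) := by
      have hle : ∀ x, F x ^ 2 ≤ 2 * M^2 * (v x ^2 + v1 x ^ 2 / τ t) := by
        intro x
        have e1 := heq (√(τ t) * x)
        have e2 : v1 x ^ 2 / τ t = (wz t (√(τ t) * x))^2 := by
          simp only [hv1]; rw [mul_pow, Real.sq_sqrt hτp.le]; field_simp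
        rw [e2]
        have : F x ^ 2 ≤ (M * (|w t (√(τ t) * x)| + |wz t (√(τ t) * x)|))^2 := by
          rw [← sq_abs]; gcongr
        refine this.trans ?_
        simp only [hv]
        rw [mul_pow, ← sq_abs (w t _), ← sq_abs (wz t _), mul_comm 2 (M^2), mul_assoc]
        gcongr
        nlinarith [sq_nonneg (|w t (√(τ t) * x)| - |wz t (√(τ t) * x)|)]
      unfold ip
      rw [← MeasureTheory.integral_div, ← MeasureTheory.integral_add (gv.integrable gv) ((gv1.integrable gv1).div_const _), ← MeasureTheory.integral_const_mul]
      refine MeasureTheory.integral_mono (gF.integrable gF) (((gv.integrable gv).add ((gv1.integrable gv1).div_const _)).const_mul _) fun x => ?_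
      have := mul_le_mul_of_nonneg_right (hle x) (gW_pos x).le
      calc _ = F x ^ 2 * gW x := by ring
        _ ≤ _ := this
        _ = _ := by ring
    calc ip F F / (2 * β) ≤ 2 * M^2 * (ip v v + ip v1 v1 / τ t) / (2 * β) := by gcongr
      _ = _ := by rw [hβ]; field_simp
  · rw [eH, eD]
    change _ ≤ 2 * ip v (fun x => β * A x + F x)
    have hip : ip v A = - ip v1 v1 := ou.ipA ou.mem
    rw [ip_add gv (gA.smul _) gF, ip_smul, hip]
    have hX : -(1/ τ t * ip v1 v1 + (2 * M + M^2) * ip v v) ≤ 2 * ip v F := by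
      have hle : ∀ x, -(1 / τ t * (v1 x * v1 x) + (2 * M + M^2) * (v x * v x)) ≤ 2 * (v x * F x) := by
        intro x
        have e1 := heq (√(τ t) * x)
        have e2 : 1 / τ t * (v1 x * v1 x) = (wz t (√(τ t) * x))^2 := by
          have : v1 x * v1 x = (wz t (√(τ t) * x))^2 * τ t := by
            simp only [hv1]
            linear_combination (wz t (√(τ t) * x))^2 * hss
          rw [this]; field_simp
        rw [e2]
        have e3 : |v x * F x| ≤ |v x| * (M * (|w t (√(τ t) * x)| + |wz t (√(τ t) * x)|)) := by
          rw [abs_mul]; gcongr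
        have e4 := neg_abs_le (v x * F x)
        simp only [hv] at *
        rw [← sq_abs (wz t _), ← abs_mul_abs_self (w t _)]
        nlinarith [sq_nonneg (|wz t (√(τ t) * x)| - M * |w t (√(τ t) * x)|)]
      unfold ip
      rw [← MeasureTheory.integral_const_mul, ← MeasureTheory.integral_const_mul, ← MeasureTheory.integral_const_mul, ← MeasureTheory.integral_add ((gv1.integrable gv1).const_mul _) ((gv.integrable gv).const_mul _), ← MeasureTheory.integral_neg]
      refine MeasureTheory.integral_mono (((gv1.integrable gv1).const_mul _).add ((gv.integrable gv).const_mul _)).neg ((gv.integrable gF).const_mul _) fun x => ?_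
      have := mul_le_mul_of_nonneg_right (hle x) (gW_pos x).le
      calc _ = -(1 / τ t * (v1 x * v1 x) + (2 * M + M^2) * (v x * v x)) * gW x := by
            ring
        _ ≤ _ := this
        _ = _ := by ring
    have : (2 * α t + 1) / τ t * ip v1 v1 = 2 * β * ip v1 v1 + 1 / τ t * ip v1 v1 := by rw [hβ]; ring
    linarith


/-- abstract ODE inequality lemma -/
lemma freq_ode {H D τ α : ℝ → ℝ} {s0 T M α0 α1 τm N0 : ℝ} (hsT : s0 < T) (hM : 0 ≤ M) (hα0 : 0 < α0)
    (hτ : ∀ t, HasDerivAt τ (-α t) t)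
    (hα : ∀ t ∈ Icc s0 T, α0 ≤ α t ∧ α t ≤ α1) (hτp : ∀ t ∈ Icc s0 T, 0 < τ t ∧ τ t ≤ τm) (h1 : 1 ≤ τm)
    (hN0 : D s0 ≤ N0 * H s0) (hN0' : 0 ≤ N0)
    (key : ∀ t ∈ Icc s0 T, ∃ Hd Dd, HasDerivAt H Hd t ∧ HasDerivAt D Dd t ∧ 0 < H t ∧ 0 ≤ D t ∧
      Dd * H t - D t * Hd ≤ H t * (M^2 / α t * (τ t * H t + D t)) ∧
      -((2 * α t + 1) / τ t * D t + (2 * M + M^2) * H t) ≤ Hd) :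
    H s0 * (τ T / τ s0) ^ (((2 * α1 + 1) * ((N0 + 1) * Real.exp (M^2 * τm / α0 * (T - s0))) + (2 * M + M^2) * τm) / α0) ≤ H T := by
  set K1 := M^2 * τm / α0 with hK1
  set Nb := (N0 + 1) * Real.exp (K1 * (T - s0)) with hNb
  set p := ((2 * α1 + 1) * Nb + (2 * M + M^2) * τm) / α0 with hp
  have hms : s0 ∈ Icc s0 T := ⟨le_rfl, hsT.le⟩
  have hmT : T ∈ Icc s0 T := ⟨hsT.le, le_rfl⟩
  have hα1 : 0 < α1 := hα0.trans_le ((hα s0 hms).1.trans (hα s0 hms).2)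
  choose! Hd Dd dH dD hHp hDp k1 k2 using key
  have hK1n : 0 ≤ K1 := by positivity
  have hNbn : 0 ≤ Nb := by positivity
  -- frequency bound
  let g : ℝ → ℝ := fun t => (D t / H t + 1) * Real.exp (-K1 * t)
  have dg : ∀ t ∈ Icc s0 T, HasDerivAt g ((Dd t * H t - D t * Hd t) / (H t)^2 * Real.exp (-K1 * t) + (D t / H t + 1) * (Real.exp (-K1 * t) * (-K1))) t := by
    intro t ht
    have := (((dD t ht).div (dH t ht) (hHp t ht).ne').add_const 1).mul (((hasDerivAt_id t).const_mul (-K1)).exp)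
    refine this.congr_deriv ?_
    simp
  have ganti : AntitoneOn g (Icc s0 T) := by
    refine antitoneOn_of_deriv_nonpos (convex_Icc _ _) (fun t ht => (dg t ht).continuousAt.continuousWithinAt) ?_ ?_
    · intro t ht
      exact (dg t (interior_subset ht)).differentiableAt.differentiableWithinAt
    · intro t ht
      have ht := interior_subset ht
      rw [(dg t ht).deriv]
      have e := Real.exp_pos (-K1 * t)
      have hH := hHp t ht
      have hD := hDp t ht
      have hb : (Dd t * H t - D t * Hd t) / (H t)^2 ≤ K1 * (D t / H t + 1) := by
        rw [div_le_iff₀ (by positivity)]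
        refine (k1 t ht).trans ?_
        have hαt := (hα t ht).1
        have hτt := hτp t ht
        calc H t * (M^2 / α t * (τ t * H t + D t)) ≤ H t * (M^2 / α0 * (τm * H t + τm * D t)) := by
              have : D t ≤ τm * D t := by nlinarith
              have : τ t * H t ≤ τm * H t := by gcongr; exact hτt.2
              have hpos : 0 ≤ τ t * H t + D t := by have := hτt.1; positivity
              gcongr
          _ = _ := by rw [hK1]; field_simp; ring
      nlinarith
  have hN : ∀ t ∈ Icc s0 T, D t ≤ Nb * H t := by
    intro t ht
    have h := ganti hms ht ht.1
    simp only [g] at h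
    have hH := hHp t ht
    have e0 : D s0 / H s0 ≤ N0 := by rw [div_le_iff₀ (hHp s0 hms)]; exact hN0
    have e1 : D t / H t + 1 ≤ (N0 + 1) * Real.exp (K1 * (t - s0)) := by
      have e := Real.exp_pos (K1 * t)
      have : (D t / H t + 1) = (D t / H t + 1) * Real.exp (-K1 * t) * Real.exp (K1 * t) := by
        rw [mul_assoc, ← Real.exp_add]; simp
      rw [this]
      calc _ ≤ (D s0 / H s0 + 1) * Real.exp (-K1 * s0) * Real.exp (K1 * t) := by gcongr
        _ = (D s0 / H s0 + 1) * Real.exp (K1 * (t - s0)) := by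
          rw [mul_assoc, ← Real.exp_add]; congr 2; ring
        _ ≤ _ := by gcongr
    have e2 : Real.exp (K1 * (t - s0)) ≤ Real.exp (K1 * (T - s0)) := by
      gcongr; exact ht.2
    have e3 : D t / H t ≤ Nb := by
      have : (N0 + 1) * Real.exp (K1 * (t - s0)) ≤ Nb := by rw [hNb]; gcongr
      linarith
    rwa [div_le_iff₀ hH] at e3
  let f : ℝ → ℝ := fun t => Real.log (H t) - p * Real.log (τ t)
  have df : ∀ t ∈ Icc s0 T, HasDerivAt f (Hd t / H t - p * (-α t / τ t)) t := by
    intro t ht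
    exact ((dH t ht).log (hHp t ht).ne').sub (((hτ t).log (hτp t ht).1.ne').const_mul p)
  have fmono : MonotoneOn f (Icc s0 T) := by
    refine monotoneOn_of_deriv_nonneg (convex_Icc _ _) (fun t ht => (df t ht).continuousAt.continuousWithinAt) ?_ ?_
    · intro t ht
      exact (df t (interior_subset ht)).differentiableAt.differentiableWithinAt
    · intro t ht
      have ht := interior_subset ht
      rw [(df t ht).deriv]
      have hH := hHp t ht
      have hD := hDp t ht
      obtain ⟨ha, hb⟩ := hα t ht
      obtain ⟨hc, hd⟩ := hτp t ht
      have hαt : 0 < α t := hα0.trans_le ha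
      have e1 : -(p * α0 / τ t) ≤ Hd t / H t := by
        rw [le_div_iff₀ hH]
        refine le_trans ?_ (k2 t ht)
        have : p * α0 = (2 * α1 + 1) * Nb + (2 * M + M^2) * τm := by rw [hp]; field_simp
        rw [this]
        have i1 : (2 * α t + 1) / τ t * D t ≤ (2 * α1 + 1) / τ t * (Nb * H t) := by
          have := hN t ht
          gcongr
        have i2 : (2 * M + M^2) * H t ≤ (2 * M + M^2) * (τm / τ t) * H t := by
          have : 1 ≤ τm / τ t := by rw [le_div_iff₀ hc]; linarith
          have h0 : 0 ≤ 2 * M + M^2 := by positivity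
          gcongr
          nlinarith
        have i3 : -(((2 * α1 + 1) * Nb + (2 * M + M ^ 2) * τm) / τ t) * H t = -((2 * α1 + 1) / τ t * (Nb * H t) + (2 * M + M^2) * (τm / τ t) * H t) := by ring
        rw [i3]
        linarith
      have hpn : 0 ≤ p := by positivity
      have e2 : p * α0 / τ t ≤ p * α t / τ t := by gcongr
      have e3 : p * (-α t / τ t) = - (p * α t / τ t) := by ring
      rw [e3]; linarith
  have hf := fmono hms hmT hsT.le
  simp only [f] at hf
  have t1 := (hτp T hmT).1
  have t0 := (hτp s0 hms).1
  have hq : 0 < τ T / τ s0 := by positivity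
  rw [← Real.log_le_log_iff (mul_pos (hHp s0 hms) (Real.rpow_pos_of_pos hq _)) (hHp T hmT),
    Real.log_mul (hHp s0 hms).ne' (Real.rpow_pos_of_pos hq _).ne', Real.log_rpow hq, Real.log_div t1.ne' t0.ne']
  linarith


lemma uc_core {w wt wz wzz : ℝ → ℝ → ℝ} (h : WS w wt wz wzz) {s0 T K : ℝ} (hsT : s0 < T)
    (bd : ∀ t ∈ Icc (s0-1) (T+1), ∀ x, |w t x| ≤ K ∧ |wt t x| ≤ K ∧ |wz t x| ≤ K ∧ |wzz t x| ≤ K)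
    {α : ℝ → ℝ} (cα : Continuous α) {α0 α1 M r : ℝ} (hα0 : 0 < α0) (hM : 0 ≤ M) (hr : 0 < r)
    (hα : ∀ t ∈ Icc s0 T, α0 ≤ α t ∧ α t ≤ α1)
    (heq : ∀ t ∈ Icc s0 T, ∀ x, |wt t x - α t * wzz t x| ≤ M * (|w t x| + |wz t x|)) 
    (hne : ∀ t ∈ Icc s0 T, ∃ x, w t x ≠ 0) 
    (hz : ∀ x, |x| < r → w T x = 0) : False := by
  have hms : s0 ∈ Icc s0 T := ⟨le_rfl, hsT.le⟩
  have hmT : T ∈ Icc s0 T := ⟨hsT.le, le_rfl⟩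
  have hms' : s0 ∈ Icc (s0-1) (T+1) := ⟨by linarith, by linarith⟩
  have hmT' : T ∈ Icc (s0-1) (T+1) := ⟨by linarith, by linarith⟩
  have hα1 : 0 < α1 := hα0.trans_le ((hα s0 hms).1.trans (hα s0 hms).2)
  have hK : 0 ≤ K := (abs_nonneg _).trans (bd s0 hms' 0).1
  let Θ : ℝ → ℝ := fun t => ∫ s in t..T, α s
  have dΘ : ∀ t, HasDerivAt Θ (-α t) t := fun t =>
    intervalIntegral.integral_hasDerivAt_left (cα.intervalIntegrable _ _)
      (cα.stronglyMeasurableAtFilter _ _) cα.continuousAt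
  have bΘ : ∀ t ∈ Icc s0 T, α0 * (T - t) ≤ Θ t ∧ Θ t ≤ α1 * (T - t) := by
    intro t ht
    constructor
    · have := intervalIntegral.integral_mono_on (μ := MeasureTheory.volume) (f := fun _ => α0) (g := α) ht.2 (continuous_const.intervalIntegrable _ _) (cα.intervalIntegrable _ _)
        (fun x hx => (hα x ⟨ht.1.trans hx.1, hx.2⟩).1)
      simp at this
      simp only [Θ]; linarith
    · have := intervalIntegral.integral_mono_on (μ := MeasureTheory.volume) (g := fun _ => α1) (f := α) ht.2 (cα.intervalIntegrable _ _) (continuous_const.intervalIntegrable _ _) 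
        (fun x hx => (hα x ⟨ht.1.trans hx.1, hx.2⟩).2)
      simp at this
      simp only [Θ]; linarith
  have hΘT : Θ T = 0 := by simp [Θ]
  set τm := 1 + α1 * (T - s0) with hτm
  have hτm1 : 1 ≤ τm := by nlinarith
  have hτm0 : 0 < τm := by linarith
  have hΘ0 : 0 < Θ s0 := lt_of_lt_of_le (by nlinarith) (bΘ s0 hms).1
  -- lower bound for H at s0
  obtain ⟨h0, hh0, hlow⟩ : ∃ h0 > 0, ∀ q ∈ Icc (Θ s0) (Θ s0 + 1), h0 ≤ ip (fun x => w s0 (√q * x)) (fun x => w s0 (√q * x)) := by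
    have cw := h.c0
    have hg := gW_cont
    have hc : Continuous (fun q : ℝ => ip (fun x => w s0 (√q * x)) (fun x => w s0 (√q * x))) := by
      unfold ip
      refine MeasureTheory.continuous_of_dominated (bound := fun x => K * K * ((1 + |x|)^2 * gW x)) ?_ ?_ (gW_int.const_mul _) ?_
      · intro q
        have := cw.comp (by fun_prop : Continuous (fun x : ℝ => (s0, √q * x)))
        simp only [Function.comp_def] at this
        exact (by fun_prop : Continuous _).aestronglyMeasurable
      · intro q
        refine Eventually.of_forall fun x => ?_
        have hp := gW_pos x
        have b := (bd s0 hms' (√q * x)).1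
        have h1 : 1 ≤ (1 + |x|)^2 := by nlinarith [abs_nonneg x]
        have h2 : ‖w s0 (√q * x) * w s0 (√q * x) * gW x‖ = |w s0 (√q * x)| * |w s0 (√q * x)| * gW x := by
          rw [norm_mul, norm_mul, Real.norm_eq_abs, Real.norm_eq_abs, abs_of_pos hp]
        refine h2.le.trans ?_
        have h3 : |w s0 (√q * x)| * |w s0 (√q * x)| ≤ K * K := mul_le_mul b b (abs_nonneg _) hK
        have h4 : gW x ≤ (1 + |x|)^2 * gW x := by nlinarith
        exact mul_le_mul h3 h4 hp.le (mul_nonneg hK hK)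
      · refine Eventually.of_forall fun x => ?_
        have := cw.comp (by fun_prop : Continuous (fun q : ℝ => (s0, √q * x)))
        simp only [Function.comp_def] at this
        fun_prop
    obtain ⟨q, hq, hmin⟩ := isCompact_Icc.exists_isMinOn (nonempty_Icc.2 (by linarith : Θ s0 ≤ Θ s0 + 1)) hc.continuousOn
    refine ⟨_, ?_, fun q' hq' => hmin hq'⟩
    obtain ⟨x, hx⟩ := hne s0 hms
    have hs : 0 < √q := Real.sqrt_pos.2 (hΘ0.trans_le hq.1)
    refine ip_self_pos (Gd.of_bdd ?_ (fun x => (bd s0 hms' (√q * x)).1)) (x0 := (√q)⁻¹ * x) ?_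
    · have := cw.comp (by fun_prop : Continuous (fun x : ℝ => (s0, √q * x)))
      exact this
    · rwa [mul_inv_cancel_left₀ hs.ne']
  set Γ := ip (fun _ => 1) (fun _ => 1) with hΓ
  have hΓ0 : 0 ≤ Γ := ip_self_nonneg _
  have g1 : Gd (fun _ => (1:ℝ)) := Gd.of_bdd continuous_const (K := 1) (by simp)
  set N0 := K^2 * τm * Γ / h0 with hN0
  have hN0' : 0 ≤ N0 := by positivity
  set p := ((2 * α1 + 1) * ((N0 + 1) * Real.exp (M^2 * τm / α0 * (T - s0))) + (2 * M + M^2) * τm) / α0 with hp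
  have hp0 : 0 ≤ p := by
    have : 0 ≤ Real.exp (M^2 * τm / α0 * (T - s0)) := (Real.exp_pos _).le
    positivity
  have i8 : MeasureTheory.Integrable (fun x : ℝ => Real.exp (-(1/8) * x^2)) := integrable_exp_neg_mul_sq (by norm_num)
  set Γ8 := ∫ x : ℝ, Real.exp (-(1/8) * x^2) with hΓ8
  have main : ∀ ε, 0 < ε → ε ≤ 1 → h0 * (ε / τm) ^ p ≤ K^2 * Real.exp (-(r^2/8) * (1/ε)) * Γ8 := by
    intro ε hε hε1
    let τ : ℝ → ℝ := fun t => ε + Θ t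
    have dτ : ∀ t, HasDerivAt τ (-α t) t := fun t => (dΘ t).const_add ε
    have bτ : ∀ t ∈ Icc s0 T, 0 < τ t ∧ τ t ≤ τm := by
      intro t ht
      have := bΘ t ht
      have h1 : 0 ≤ α0 * (T - t) := mul_nonneg hα0.le (by linarith [ht.2])
      have h2 : α1 * (T - t) ≤ α1 * (T - s0) := by gcongr; exact ht.1
      simp only [τ, hτm]
      constructor <;> linarith
    have hl := hlow (τ s0) ⟨by simp only [τ]; linarith, by simp only [τ]; linarith⟩
    have hode := freq_ode (H := HH w τ) (D := DD wz τ) (N0 := N0) hsT hM hα0 dτ hα bτ hτm1 ?_ hN0' ?_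
    · have hτT : τ T = ε := by simp [τ, hΘT]
      rw [hτT, ← hp] at hode
      have b0 := bτ s0 hms
      have l1 : h0 * (ε / τm) ^ p ≤ HH w τ s0 * (ε / τ s0) ^ p := by
        have e1 : ε / τm ≤ ε / τ s0 := div_le_div_of_nonneg_left hε.le b0.1 b0.2
        have : (ε / τm) ^ p ≤ (ε / τ s0) ^ p := Real.rpow_le_rpow (by positivity) e1 hp0
        have h3 : 0 ≤ (ε / τm) ^ p := by positivity
        exact mul_le_mul hl this h3 (hh0.le.trans hl)
      refine (l1.trans hode).trans ?_
      unfold HH ip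
      rw [hτT, ← MeasureTheory.integral_const_mul]
      have gw : Gd (fun x => w T (√ε * x)) := by
        refine Gd.of_bdd ?_ (fun x => (bd T hmT' (√ε * x)).1)
        exact h.c0.comp (by fun_prop : Continuous (fun x : ℝ => (T, √ε * x)))
      refine MeasureTheory.integral_mono (gw.integrable gw) (i8.const_mul _) fun x => ?_
      simp only
      by_cases hx : |√ε * x| < r
      · rw [hz _ hx]; simp; positivity
      · push Not at hx
        have hx2 : r^2 / ε ≤ x^2 := by
          rw [div_le_iff₀ hε]
          have : r^2 ≤ |√ε * x|^2 := by gcongr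
          rw [sq_abs, mul_pow, Real.sq_sqrt hε.le] at this
          linarith
        have e1 : w T (√ε * x) * w T (√ε * x) ≤ K^2 := by
          rw [← abs_mul_abs_self]
          have := (bd T hmT' (√ε * x)).1
          nlinarith [abs_nonneg (w T (√ε * x))]
        have e2 : gW x ≤ Real.exp (-(r^2/8) * (1/ε)) * Real.exp (-(1/8) * x^2) := by
          unfold gW
          rw [← Real.exp_add]
          apply Real.exp_le_exp.2
          have : -(r^2/8) * (1/ε) = -(1/8) * (r^2/ε) := by ring
          rw [this]; linarith
        rw [mul_assoc (K^2)]
        exact mul_le_mul e1 e2 (gW_pos x).le (by positivity)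
    · -- D s0 bound
      have b0 := bτ s0 hms
      have : DD wz τ s0 ≤ K^2 * τm * Γ := by
        unfold DD
        have e : K^2 * τm * Γ = ip (fun _ => K * √τm * 1) (fun _ => K * √τm * 1) := by
          rw [ip_smul, ip_comm, ip_smul, ← hΓ]
          have := Real.mul_self_sqrt hτm0.le
          linear_combination (-K^2 * Γ) * this
        rw [e]
        have gz : Gd (fun x => wz s0 (√(τ s0) * x) * √(τ s0)) := by
          refine Gd.of_bdd (K := K * √(τ s0)) ?_ (fun x => ?_)
          · exact (h.c1.comp (by fun_prop : Continuous (fun x : ℝ => (s0, √(τ s0) * x)))).mul_const _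
          · rw [abs_mul, abs_of_nonneg (Real.sqrt_nonneg _)]
            have := (bd s0 hms' (√(τ s0) * x)).2.2.1
            gcongr
        refine ip_mono gz gz (g1.smul _) (g1.smul _) fun x => ?_
        rw [← abs_mul_abs_self]
        have e3 : |wz s0 (√(τ s0) * x) * √(τ s0)| ≤ K * √τm * 1 := by
          rw [abs_mul, abs_of_nonneg (Real.sqrt_nonneg _), mul_one]
          have := (bd s0 hms' (√(τ s0) * x)).2.2.1
          have := Real.sqrt_le_sqrt b0.2
          gcongr
        exact mul_le_mul e3 e3 (abs_nonneg _) (by positivity)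
      refine this.trans ?_
      have hl' : h0 ≤ HH w τ s0 := hl
      calc K^2 * τm * Γ = N0 * h0 := by rw [hN0]; field_simp
        _ ≤ _ := by gcongr
    · intro t ht
      exact h.pt bd cα dτ ht (hα0.trans_le (hα t ht).1) (bτ t ht).1 hM (heq t ht) (hne t ht)
  -- contradiction
  have lim := (tendsto_rpow_mul_exp_neg_mul_atTop_nhds_zero p (r^2/8) (by positivity)).const_mul (K^2 * Γ8)
  rw [mul_zero] at lim
  have hpos : 0 < h0 * (1 / τm) ^ p := by positivity
  obtain ⟨y, hy, hy1⟩ := ((lim.eventually (gt_mem_nhds hpos)).and (eventually_ge_atTop 1)).exists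
  have hy0 : 0 < y := by linarith
  have := main (1/y) (by positivity) (by rw [div_le_one hy0]; exact hy1)
  have e : (1 / y / τm) ^ p = (1/τm)^p / y^p := by
    rw [← Real.div_rpow (by positivity) hy0.le]; congr 1; field_simp
  have hyp : 0 < y ^ p := by positivity
  rw [e, one_div_one_div] at this
  have h5 : h0 * (1/τm)^p ≤ K^2 * Real.exp (-(r^2/8) * y) * Γ8 * y^p := by
    have := mul_le_mul_of_nonneg_right this hyp.le
    calc _ = h0 * ((1/τm)^p / y^p) * y^p := by field_simp
      _ ≤ _ := this
  have h6 : K ^ 2 * Γ8 * (y ^ p * rexp (-(r ^ 2 / 8) * y)) = K^2 * Real.exp (-(r^2/8) * y) * Γ8 * y^p := by ring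
  linarith


lemma per_bound {f : ℝ → ℝ → ℝ} (cf : Continuous (fun p : ℝ × ℝ => f p.1 p.2))
    (pf : ∀ t x, f t (x + 2 * π) = f t x) (s T : ℝ) : ∃ K, ∀ t ∈ Icc s T, ∀ x, |f t x| ≤ K := by
  obtain ⟨K, hK⟩ := ((isCompact_Icc (a := s) (b := T)).prod (isCompact_Icc (a := (0:ℝ)) (b := 2 * π))).exists_bound_of_continuousOn
    cf.continuousOn
  refine ⟨K, fun t ht x => ?_⟩
  obtain ⟨y, hy, e⟩ := Function.Periodic.exists_mem_Ico₀ (f := f t) (pf t) (by positivity) x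
  rw [e]
  exact hK (t, y) ⟨ht, Ico_subset_Icc_self hy⟩

lemma per_deriv {f g : ℝ → ℝ} (h : ∀ x, HasDerivAt f (g x) x) (pf : ∀ x, f (x + 2 * π) = f x) (x : ℝ) :
    g (x + 2 * π) = g x := by
  have h1 := (h (x + 2 * π)).comp_add_const x (2 * π)
  have : (fun x => f (x + 2 * π)) = f := funext pf
  rw [this] at h1
  exact h1.unique (h x)

lemma per_deriv_t {f g : ℝ → ℝ → ℝ} (h : ∀ t x, HasDerivAt (fun s => f s x) (g t x) t) (pf : ∀ t x, f t (x + 2 * π) = f t x) (t x : ℝ) :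
    g t (x + 2 * π) = g t x := by
  have h1 := h t (x + 2 * π)
  simp only [pf] at h1
  exact h1.unique (h t x)

lemma inv_lemma {Z Zt Zx : ℝ → ℝ → ℝ} (ct : Continuous (fun p : ℝ × ℝ => Zt p.1 p.2))
    (cx : Continuous (fun p : ℝ × ℝ => Zx p.1 p.2))
    (c : Continuous (fun p : ℝ × ℝ => Z p.1 p.2))
    (ht : ∀ t x, HasDerivAt (fun s => Z s x) (Zt t x) t)
    (hx : ∀ t x, HasDerivAt (Z t) (Zx t x) x) (hpos : ∀ t x, 0 < Zx t x)
    (per : ∀ t x, Z t (x + 2 * π) = Z t x + 2 * π) :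
    ∃ X : ℝ → ℝ → ℝ, Continuous (fun p : ℝ × ℝ => X p.1 p.2) ∧ (∀ t z, Z t (X t z) = z) ∧
      (∀ t x, X t (Z t x) = x) ∧
      (∀ t z, HasDerivAt (X t) (1 / Zx t (X t z)) z) ∧
      (∀ t z, HasDerivAt (fun s => X s z) (-(Zt t (X t z) / Zx t (X t z))) t) := by
  have mono : ∀ t, StrictMono (Z t) := fun t => strictMono_of_deriv_pos fun x => by
    rw [(hx t x).deriv]; exact hpos t x
  have pern : ∀ (n : ℕ) t x, Z t (x + n * (2 * π)) = Z t x + n * (2 * π) := by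
    intro n t
    induction n with
    | zero => simp
    | succ n ih =>
      intro x
      have := per t (x + n * (2 * π))
      rw [ih] at this
      push_cast
      rw [show x + (n + 1) * (2 * π) = x + n * (2 * π) + 2 * π by ring, this]; ring
  have surj : ∀ t z, ∃ x, Z t x = z := by
    intro t z
    have cz : Continuous (Z t) := continuous_iff_continuousAt.2 fun x => (hx t x).continuousAt
    obtain ⟨n, hn⟩ := exists_nat_gt (|z - Z t 0|)
    have h1 : (n:ℝ) ≤ n * (2 * π) := by
      have := Real.pi_gt_three; have : (0:ℝ) ≤ n := n.cast_nonneg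
      nlinarith
    have h2 := abs_lt.1 hn
    refine mem_range_of_exists_le_of_exists_ge cz ⟨0 - n * (2 * π), ?_⟩ ⟨0 + n * (2 * π), ?_⟩
    · have := pern n t (0 - n * (2 * π))
      rw [sub_add_cancel] at this; linarith
    · rw [pern]; linarith
  choose X hX using surj
  have hX' : ∀ t x, X t (Z t x) = x := fun t x => (mono t).injective (hX t _)
  have cX : Continuous (fun p : ℝ × ℝ => X p.1 p.2) := by
    rw [continuous_iff_continuousAt]
    rintro ⟨t, z⟩
    refine Metric.tendsto_nhds.2 fun ε hε => ?_
    have e1 : Z t (X t z - ε) < z := by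
      conv_rhs => rw [← hX t z]
      exact mono t (by linarith)
    have e2 : z < Z t (X t z + ε) := by
      conv_lhs => rw [← hX t z]
      exact mono t (by linarith)
    have c1 : ContinuousAt (fun p : ℝ × ℝ => Z p.1 (X t z - ε) - p.2) (t, z) :=
      ((c.comp (by fun_prop : Continuous (fun p : ℝ × ℝ => (p.1, X t z - ε)))).sub continuous_snd).continuousAt
    have c2 : ContinuousAt (fun p : ℝ × ℝ => Z p.1 (X t z + ε) - p.2) (t, z) :=
      ((c.comp (by fun_prop : Continuous (fun p : ℝ × ℝ => (p.1, X t z + ε)))).sub continuous_snd).continuousAt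
    filter_upwards [c1.eventually (gt_mem_nhds (show Z t (X t z - ε) - z < 0 by linarith)),
      c2.eventually (lt_mem_nhds (show 0 < Z t (X t z + ε) - z by linarith))] with p h1 h2
    rw [Real.dist_eq, abs_lt]
    have h1' : Z p.1 (X t z - ε) < Z p.1 (X p.1 p.2) := by rw [hX]; linarith
    have h2' : Z p.1 (X p.1 p.2) < Z p.1 (X t z + ε) := by rw [hX]; linarith
    have := (mono _).lt_iff_lt.1 h1'
    have := (mono _).lt_iff_lt.1 h2'
    constructor <;> linarith
  have key : ∀ t z, HasFDerivAt (fun p : ℝ × ℝ => (p.1, X p.1 p.2))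
      ((ContinuousLinearMap.fst ℝ ℝ ℝ).prod ((-(Zt t (X t z) / Zx t (X t z))) • ContinuousLinearMap.fst ℝ ℝ ℝ + (1 / Zx t (X t z)) • ContinuousLinearMap.snd ℝ ℝ ℝ)) (t, z) := by
    intro t z
    set x := X t z with hxd
    have h := hasStrictFDerivAt_uncurry_coprod (𝕜 := ℝ) (u := (t, x)) (f := Z)
      (f₁ := fun t x => ContinuousLinearMap.toSpanSingleton ℝ (Zt t x))
      (f₂ := fun t x => ContinuousLinearMap.toSpanSingleton ℝ (Zx t x))
      (Eventually.of_forall fun p => (ht p.1 p.2).hasFDerivAt)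
      (Eventually.of_forall fun p => (hx p.1 p.2).hasFDerivAt)
      (by
        have : Continuous (fun p : ℝ × ℝ => ContinuousLinearMap.toSpanSingleton ℝ (Zt p.1 p.2)) :=
          (ContinuousLinearMap.toSpanSingletonLIE ℝ ℝ).continuous.comp ct
        exact this.continuousAt)
      (by
        have : Continuous (fun p : ℝ × ℝ => ContinuousLinearMap.toSpanSingleton ℝ (Zx p.1 p.2)) :=
          (ContinuousLinearMap.toSpanSingletonLIE ℝ ℝ).continuous.comp cx
        exact this.continuousAt)
    have hne := (hpos t x).ne'
    let f' : (ℝ × ℝ) ≃L[ℝ] (ℝ × ℝ) := ContinuousLinearEquiv.equivOfInverse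
      ((ContinuousLinearMap.fst ℝ ℝ ℝ).prod ((Zt t x) • ContinuousLinearMap.fst ℝ ℝ ℝ + (Zx t x) • ContinuousLinearMap.snd ℝ ℝ ℝ))
      ((ContinuousLinearMap.fst ℝ ℝ ℝ).prod ((-(Zt t x / Zx t x)) • ContinuousLinearMap.fst ℝ ℝ ℝ + (1 / Zx t x) • ContinuousLinearMap.snd ℝ ℝ ℝ))
      (by
        rintro ⟨p, q⟩
        simp
        field_simp
        ring)
      (by
        rintro ⟨p, q⟩
        simp
        field_simp
        ring)
    have hf : HasFDerivAt (fun p : ℝ × ℝ => (p.1, Z p.1 p.2)) (f' : (ℝ × ℝ) →L[ℝ] (ℝ × ℝ)) (t, x) := by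
      refine hasFDerivAt_fst.prodMk ?_
      refine h.hasFDerivAt.congr_fderiv ?_
      ext <;> simp [Function.HasUncurry.uncurry]
    exact HasFDerivAt.of_local_left_inverse (f := fun p : ℝ × ℝ => (p.1, Z p.1 p.2)) (f' := f')
      (g := fun p : ℝ × ℝ => (p.1, X p.1 p.2)) (a := (t, z))
      (by exact (continuous_fst.prodMk cX).continuousAt) hf (Eventually.of_forall fun p => by simp [hX])
  refine ⟨X, cX, hX, hX', fun t z => ?_, fun t z => ?_⟩
  · have h1 := (key t z).snd.comp_hasDerivAt z ((hasDerivAt_const z t).prodMk (hasDerivAt_id z))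
    refine h1.congr_deriv ?_
    simp
  · have h1 := (key t z).snd.comp_hasDerivAt t ((hasDerivAt_id t).prodMk (hasDerivAt_const t z))
    refine h1.congr_deriv ?_
    simp


structure Sol (a b c a_t a_x u ut ux uxx : ℝ → ℝ → ℝ) : Prop where
  ca : Continuous (fun p : ℝ × ℝ => a p.1 p.2)
  cb : Continuous (fun p : ℝ × ℝ => b p.1 p.2)
  cc : Continuous (fun p : ℝ × ℝ => c p.1 p.2)
  cat : Continuous (fun p : ℝ × ℝ => a_t p.1 p.2)
  cax : Continuous (fun p : ℝ × ℝ => a_x p.1 p.2)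
  cu : Continuous (fun p : ℝ × ℝ => u p.1 p.2)
  cut : Continuous (fun p : ℝ × ℝ => ut p.1 p.2)
  cux : Continuous (fun p : ℝ × ℝ => ux p.1 p.2)
  cuxx : Continuous (fun p : ℝ × ℝ => uxx p.1 p.2)
  dat : ∀ t x, HasDerivAt (fun s => a s x) (a_t t x) t
  dax : ∀ t x, HasDerivAt (a t) (a_x t x) x
  dut : ∀ t x, HasDerivAt (fun s => u s x) (ut t x) t
  dux : ∀ t x, HasDerivAt (u t) (ux t x) x
  duxx : ∀ t x, HasDerivAt (ux t) (uxx t x) x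
  apos : ∀ t x, 0 < a t x
  pa : ∀ t x, a t (x + 2 * π) = a t x
  pb : ∀ t x, b t (x + 2 * π) = b t x
  pc : ∀ t x, c t (x + 2 * π) = c t x
  pu : ∀ t x, u t (x + 2 * π) = u t x
  eq : ∀ t x, ut t x = a t x * uxx t x + b t x * ux t x + c t x * u t x
  ne : ∀ t, ∃ x, u t x ≠ 0

/-- derivative of parametric integral -/
lemma param_deriv {f ft : ℝ → ℝ → ℝ} (c : Continuous (fun p : ℝ × ℝ => f p.1 p.2))
    (ct : Continuous (fun p : ℝ × ℝ => ft p.1 p.2))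
    (ht : ∀ t x, HasDerivAt (fun s => f s x) (ft t x) t) (p q t : ℝ) :
    HasDerivAt (fun s => ∫ y in p..q, f s y) (∫ y in p..q, ft t y) t := by
  obtain ⟨K, hK⟩ := ((isCompact_Icc (a := t - 1) (b := t + 1)).prod (isCompact_uIcc (a := p) (b := q))).exists_bound_of_continuousOn
    ct.continuousOn
  have c1 : ∀ s, Continuous (f s) := fun s => c.comp (by fun_prop : Continuous (fun x : ℝ => (s, x)))
  have c2 : ∀ s, Continuous (ft s) := fun s => ct.comp (by fun_prop : Continuous (fun x : ℝ => (s, x)))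
  refine (intervalIntegral.hasDerivAt_integral_of_dominated_loc_of_deriv_le (F := f) (F' := ft) (bound := fun _ => K)
    (s := Icc (t-1) (t+1)) (Icc_mem_nhds (by linarith) (by linarith)) (Eventually.of_forall fun s => (c1 s).aestronglyMeasurable)
    ((c1 t).intervalIntegrable _ _) (c2 t).aestronglyMeasurable ?_ (continuous_const.intervalIntegrable _ _) ?_).2
  · exact Eventually.of_forall fun x hx s hs => hK (s, x) ⟨hs, uIoc_subset_uIcc hx⟩
  · exact Eventually.of_forall fun x hx s hs => ht s x

/-- normalising change of coordinates -/
lemma coord {n nt : ℝ → ℝ → ℝ} (c : Continuous (fun p : ℝ × ℝ => n p.1 p.2))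
    (ct : Continuous (fun p : ℝ × ℝ => nt p.1 p.2))
    (ht : ∀ t x, HasDerivAt (fun s => n s x) (nt t x) t) (hpos : ∀ t x, 0 < n t x)
    (pn : ∀ t x, n t (x + 2 * π) = n t x) (x0 : ℝ) :
    ∃ (k : ℝ → ℝ) (Z Zt : ℝ → ℝ → ℝ), Continuous k ∧ (∀ t, 0 < k t) ∧
      Continuous (fun p : ℝ × ℝ => Z p.1 p.2) ∧ Continuous (fun p : ℝ × ℝ => Zt p.1 p.2) ∧
      (∀ t x, HasDerivAt (fun s => Z s x) (Zt t x) t) ∧ 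
      (∀ t x, HasDerivAt (Z t) (k t * n t x) x) ∧ (∀ t x, Z t (x + 2 * π) = Z t x + 2 * π) ∧
      (∀ t x, Zt t (x + 2 * π) = Zt t x) ∧ ∀ t, Z t x0 = 0 := by
  let P : ℝ → ℝ → ℝ := fun t x => ∫ y in x0..x, n t y
  let Pt : ℝ → ℝ → ℝ := fun t x => ∫ y in x0..x, nt t y
  have c1 : ∀ s, Continuous (n s) := fun s => c.comp (by fun_prop : Continuous (fun x : ℝ => (s, x)))
  have cP : Continuous (fun p : ℝ × ℝ => P p.1 p.2) := intervalIntegral.continuous_parametric_primitive_of_continuous (f := n) c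
  have cPt : Continuous (fun p : ℝ × ℝ => Pt p.1 p.2) := intervalIntegral.continuous_parametric_primitive_of_continuous (f := nt) ct
  have dP : ∀ t x, HasDerivAt (fun s => P s x) (Pt t x) t := fun t x => param_deriv c ct ht x0 x t
  have dPx : ∀ t x, HasDerivAt (P t) (n t x) x := fun t x =>
    intervalIntegral.integral_hasDerivAt_right ((c1 t).intervalIntegrable _ _) ((c1 t).stronglyMeasurableAtFilter _ _) (c1 t).continuousAt
  let L : ℝ → ℝ := fun t => P t (x0 + 2 * π)
  let Lt : ℝ → ℝ := fun t => Pt t (x0 + 2 * π)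
  have cL : Continuous L := cP.comp (by fun_prop : Continuous (fun t : ℝ => (t, x0 + 2 * π)))
  have cLt : Continuous Lt := cPt.comp (by fun_prop : Continuous (fun t : ℝ => (t, x0 + 2 * π)))
  have Lpos : ∀ t, 0 < L t := fun t => 
    intervalIntegral.intervalIntegral_pos_of_pos ((c1 t).intervalIntegrable _ _) (hpos t) (by have := Real.pi_pos; linarith)
  have PL : ∀ t x, P t (x + 2 * π) = P t x + L t := by
    intro t x
    have h1 := intervalIntegral.integral_add_adjacent_intervals (a := x0) (b := x) (c := x + 2 * π) 
      ((c1 t).intervalIntegrable (μ := MeasureTheory.volume) _ _) ((c1 t).intervalIntegrable _ _)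
    have h2 := Function.Periodic.intervalIntegral_add_eq (f := n t) (T := 2 * π) (pn t) x x0
    simp only [P, L]
    rw [← h1, h2]
  have hπ := Real.pi_pos
  let k : ℝ → ℝ := fun t => 2 * π / L t
  let Z : ℝ → ℝ → ℝ := fun t x => 2 * π * P t x / L t
  let Zt : ℝ → ℝ → ℝ := fun t x => (2 * π * Pt t x * L t - 2 * π * P t x * Lt t) / (L t) ^ 2
  have hLne : ∀ t, L t ≠ 0 := fun t => (Lpos t).ne'
  have dZt : ∀ t x, HasDerivAt (fun s => Z s x) (Zt t x) t := fun t x =>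
    ((dP t x).const_mul (2 * π)).div (dP t (x0 + 2 * π)) (hLne t)
  have pZ : ∀ t x, Z t (x + 2 * π) = Z t x + 2 * π := by
    intro t x
    simp only [Z, PL]
    have := hLne t
    field_simp
  refine ⟨k, Z, Zt, ?_, fun t => by have := Lpos t; positivity, ?_, ?_, dZt, ?_, pZ, ?_, ?_⟩
  · exact continuous_const.div cL hLne
  · exact (continuous_const.mul cP).div (cL.comp continuous_fst) fun p => hLne _
  · have := cL.comp (continuous_fst (X := ℝ) (Y := ℝ))
    have := cLt.comp (continuous_fst (X := ℝ) (Y := ℝ))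
    exact Continuous.div (by fun_prop) (by fun_prop) fun p => pow_ne_zero 2 (hLne _)
  · intro t x
    refine (((dPx t x).const_mul (2 * π)).div_const (L t)).congr_deriv ?_
    simp only [k]; ring
  · intro t x
    have h1 := dZt t (x + 2 * π)
    simp only [pZ] at h1
    exact h1.unique ((dZt t x).add_const _)
  · intro t; simp [Z, P]

lemma Sol.hU {a b c a_t a_x u ut ux uxx : ℝ → ℝ → ℝ} (h : Sol a b c a_t a_x u ut ux uxx) (T : ℝ) {l m : ℝ} (hlm : l < m) :
    ∃ x ∈ Ioo l m, u T x ≠ 0 := by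
  by_contra hcon
  push Not at hcon
  set x0 := (l + m) / 2 with hx0
  have cs : Continuous (fun p : ℝ × ℝ => √(a p.1 p.2)) := h.ca.sqrt
  have spos : ∀ t x, 0 < √(a t x) := fun t x => Real.sqrt_pos.2 (h.apos t x)
  have ca := h.ca
  have cb := h.cb
  have cc := h.cc
  have cat := h.cat
  have cax := h.cax
  have cu := h.cu
  have cut := h.cut
  have cux := h.cux
  have cuxx := h.cuxx
  have ss : ∀ t x, √(a t x) * √(a t x) = a t x := fun t x => Real.mul_self_sqrt (h.apos t x).le
  obtain ⟨k, Z, Zt, ck, kpos, cZ, cZt, dZt, dZx, pZ, pZt, Z0⟩ := coord (n := fun t x => 1 / √(a t x))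
    (nt := fun t x => - (a_t t x / (2 * √(a t x))) / (√(a t x))^2)
    (continuous_const.div cs fun p => (spos _ _).ne')
    (Continuous.div (Continuous.neg (cat.div (by fun_prop) fun p => by have := spos p.1 p.2; positivity)) (by fun_prop)
      fun p => by have := spos p.1 p.2; positivity)
    (by
      intro t x
      have := ((h.dat t x).sqrt (h.apos t x).ne').inv (spos t x).ne'
      simp only [one_div]
      exact this)
    (fun t x => by have := spos t x; positivity)
    (by intro t x; simp only [h.pa]) x0
  have cn : Continuous (fun p : ℝ × ℝ => k p.1 * (1 / √(a p.1 p.2))) :=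
    (ck.comp continuous_fst).mul (continuous_const.div cs fun p => (spos _ _).ne')
  obtain ⟨X, cX, ZX, XZ, dXz, dXt⟩ := inv_lemma (Zx := fun t x => k t * (1 / √(a t x))) cZt cn cZ dZt dZx
    (fun t x => by have := spos t x; have := kpos t; positivity) pZ
  have X0 : X T 0 = x0 := by rw [← Z0 T, XZ]
  -- coefficients
  let e : ℝ → ℝ → ℝ := fun t x => √(a t x) / k t
  let ex : ℝ → ℝ → ℝ := fun t x => a_x t x / (2 * √(a t x)) / k t
  let g : ℝ → ℝ → ℝ := fun t x => - (Zt t x * e t x)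
  have ck' : Continuous (fun p : ℝ × ℝ => k p.1) := ck.comp continuous_fst
  have ce : Continuous (fun p : ℝ × ℝ => e p.1 p.2) := cs.div ck' fun p => (kpos _).ne'
  have cex : Continuous (fun p : ℝ × ℝ => ex p.1 p.2) := 
    (cax.div (by fun_prop) fun p => by have := spos p.1 p.2; positivity).div ck' fun p => (kpos _).ne'
  have cg : Continuous (fun p : ℝ × ℝ => g p.1 p.2) := (cZt.mul ce).neg
  have dex : ∀ t x, HasDerivAt (e t) (ex t x) x := fun t x => ((h.dax t x).sqrt (h.apos t x).ne').div_const _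
  have epos : ∀ t x, 0 < e t x := fun t x => div_pos (spos _ _) (kpos _)
  have dXz' : ∀ t z, HasDerivAt (X t) (e t (X t z)) z := by
    intro t z
    refine (dXz t z).congr_deriv ?_
    simp only [e]
    field_simp
  have dXt' : ∀ t z, HasDerivAt (fun s => X s z) (g t (X t z)) t := by
    intro t z
    refine (dXt t z).congr_deriv ?_
    simp only [g, e]
    field_simp
  let F1 : ℝ → ℝ → ℝ := fun t x => ut t x + ux t x * g t x
  let F2 : ℝ → ℝ → ℝ := fun t x => ux t x * e t x
  let F3 : ℝ → ℝ → ℝ := fun t x => (uxx t x * e t x + ux t x * ex t x) * e t x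
  have cF1 : Continuous (fun p : ℝ × ℝ => F1 p.1 p.2) := cut.add (cux.mul cg)
  have cF2 : Continuous (fun p : ℝ × ℝ => F2 p.1 p.2) := cux.mul ce
  have cF3 : Continuous (fun p : ℝ × ℝ => F3 p.1 p.2) := ((cuxx.mul ce).add (cux.mul cex)).mul ce
  have pux : ∀ t x, ux t (x + 2 * π) = ux t x := fun t => per_deriv (h.dux t) (h.pu t)
  have puxx : ∀ t x, uxx t (x + 2 * π) = uxx t x := fun t => per_deriv (h.duxx t) (pux t)
  have pax : ∀ t x, a_x t (x + 2 * π) = a_x t x := fun t => per_deriv (h.dax t) (h.pa t)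
  have put : ∀ t x, ut t (x + 2 * π) = ut t x := per_deriv_t h.dut h.pu
  have pe : ∀ t x, e t (x + 2 * π) = e t x := fun t x => by simp only [e, h.pa]
  have pex : ∀ t x, ex t (x + 2 * π) = ex t x := fun t x => by simp only [ex, h.pa, pax]
  have pg : ∀ t x, g t (x + 2 * π) = g t x := fun t x => by simp only [g, pZt, pe]
  have pF1 : ∀ t x, F1 t (x + 2 * π) = F1 t x := fun t x => by simp only [F1, put, pux, pg]
  have pF2 : ∀ t x, F2 t (x + 2 * π) = F2 t x := fun t x => by simp only [F2, pux, pe]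
  have pF3 : ∀ t x, F3 t (x + 2 * π) = F3 t x := fun t x => by simp only [F3, puxx, pux, pe, pex]
  have cTX : Continuous (fun p : ℝ × ℝ => (p.1, X p.1 p.2)) := continuous_fst.prodMk cX
  have ws : WS (fun t z => u t (X t z)) (fun t z => F1 t (X t z)) (fun t z => F2 t (X t z)) (fun t z => F3 t (X t z)) := by
    refine ⟨cu.comp cTX, cF1.comp cTX, cF2.comp cTX, cF3.comp cTX, ?_, ?_, ?_⟩
    · intro t z
      exact chain2 cut cux h.dut h.dux (dXt' t z)
    · intro t z
      exact (h.dux t (X t z)).comp z (dXz' t z)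
    · intro t z
      have := ((h.duxx t (X t z)).mul (dex t (X t z))).comp z (dXz' t z)
      exact this
  obtain ⟨K0, b0⟩ := per_bound cu h.pu (T - 1 - 1) (T + 1)
  obtain ⟨K1, b1⟩ := per_bound cF1 pF1 (T - 1 - 1) (T + 1)
  obtain ⟨K2, b2⟩ := per_bound cF2 pF2 (T - 1 - 1) (T + 1)
  obtain ⟨K3, b3⟩ := per_bound cF3 pF3 (T - 1 - 1) (T + 1)
  let q : ℝ → ℝ → ℝ := fun t x => (b t x + g t x - a_x t x / 2) / e t x
  have cq : Continuous (fun p : ℝ × ℝ => q p.1 p.2) := 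
    Continuous.div ((cb.add cg).sub (cax.div_const 2)) ce fun p => (epos _ _).ne'
  have pq : ∀ t x, q t (x + 2 * π) = q t x := fun t x => by simp only [q, h.pb, pg, pax, pe]
  obtain ⟨M1, m1⟩ := per_bound cq pq (T - 1) T
  obtain ⟨M2, m2⟩ := per_bound cc h.pc (T - 1) T
  -- alpha bounds
  have cα : Continuous (fun t => (k t)^2) := by fun_prop
  obtain ⟨α0, hα0, hα0'⟩ : ∃ α0 > 0, ∀ t ∈ Icc (T-1) T, α0 ≤ (k t)^2 := by
    obtain ⟨t0, _, ht⟩ := isCompact_Icc.exists_isMinOn (nonempty_Icc.2 (by linarith : T - 1 ≤ T)) cα.continuousOn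
    exact ⟨(k t0)^2, by have := kpos t0; positivity, fun t h => ht h⟩
  obtain ⟨α1, hα1⟩ : ∃ α1, ∀ t ∈ Icc (T-1) T, (k t)^2 ≤ α1 := by
    obtain ⟨t0, _, ht⟩ := isCompact_Icc.exists_isMaxOn (nonempty_Icc.2 (by linarith : T - 1 ≤ T)) cα.continuousOn
    exact ⟨(k t0)^2, fun t h => ht h⟩
  have hmT : T ∈ Icc (T-1) T := ⟨by linarith, le_rfl⟩
  have hM1 : 0 ≤ M1 := (abs_nonneg _).trans (m1 T hmT 0)
  have hM2 : 0 ≤ M2 := (abs_nonneg _).trans (m2 T hmT 0)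
  obtain ⟨r, hr, hball⟩ : ∃ r > 0, ∀ z, |z| < r → X T z ∈ Ioo l m := by
    have c0 : Continuous (X T) := cX.comp (by fun_prop : Continuous (fun z : ℝ => (T, z)))
    have : ∀ᶠ z in nhds (0:ℝ), X T z ∈ Ioo l m := by
      refine c0.continuousAt.eventually (Ioo_mem_nhds ?_ ?_) <;> rw [X0] <;> simp only [hx0] <;> linarith
    obtain ⟨r, hr, H⟩ := Metric.eventually_nhds_iff.1 this
    exact ⟨r, hr, fun z hz => H (by simpa [Real.dist_eq] using hz)⟩
  refine uc_core ws (s0 := T - 1) (T := T) (K := max (max K0 K1) (max K2 K3)) (M := M1 + M2) (r := r) (α := fun t => (k t)^2)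
    (by linarith) ?_ cα hα0 (by positivity) hr (fun t ht => ⟨hα0' t ht, hα1 t ht⟩) ?_ ?_ ?_
  · intro t ht x
    refine ⟨(b0 t ht _).trans ?_, (b1 t ht _).trans ?_, (b2 t ht _).trans ?_, (b3 t ht _).trans ?_⟩ <;> simp
  · intro t ht z
    set x := X t z
    have e1 : F1 t x - (k t)^2 * F3 t x = q t x * F2 t x + c t x * u t x := by
      have h1 : q t x * F2 t x = (b t x + g t x - a_x t x / 2) * ux t x := by
        simp only [q, F2]
        have := (epos t x).ne'
        field_simp
      have h2 : (k t)^2 * F3 t x = a t x * uxx t x + a_x t x / 2 * ux t x := by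
        rw [← ss]
        simp only [F3, e, ex]
        have := (kpos t).ne'
        have := (spos t x).ne'
        field_simp
      rw [h1, h2]
      simp only [F1]
      rw [h.eq]; ring
    rw [e1]
    have := abs_add_le (q t x * F2 t x) (c t x * u t x)
    rw [abs_mul (q t x), abs_mul (c t x)] at this
    have i1 := m1 t ht x
    have i2 := m2 t ht x
    have := abs_nonneg (F2 t x)
    have := abs_nonneg (u t x)
    have j1 := mul_le_mul_of_nonneg_right i1 (abs_nonneg (F2 t x))
    have j2 := mul_le_mul_of_nonneg_right i2 (abs_nonneg (u t x))
    have j3 := mul_nonneg hM1 (abs_nonneg (u t x))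
    have j4 := mul_nonneg hM2 (abs_nonneg (F2 t x))
    change _ ≤ (M1 + M2) * (|u t x| + |F2 t x|)
    linarith
  · intro t ht
    obtain ⟨x, hx⟩ := h.ne t
    exact ⟨Z t x, by simpa only [XZ] using hx⟩
  · intro z hz
    exact hcon _ (hball z hz)


lemma WS.sub {w wt wz wzz v vt vz vzz : ℝ → ℝ → ℝ} (h : WS w wt wz wzz) (g : WS v vt vz vzz) :
    WS (fun t x => w t x - v t x) (fun t x => wt t x - vt t x) (fun t x => wz t x - vz t x) (fun t x => wzz t x - vzz t x) :=
  ⟨h.c0.sub g.c0, h.ct.sub g.ct, h.c1.sub g.c1, h.c2.sub g.c2, fun t x => (h.ht t x).sub (g.ht t x),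
    fun t x => (h.hx t x).sub (g.hx t x), fun t x => (h.hxx t x).sub (g.hxx t x)⟩

lemma WS.neg {w wt wz wzz : ℝ → ℝ → ℝ} (h : WS w wt wz wzz) :
    WS (fun t x => -w t x) (fun t x => -wt t x) (fun t x => -wz t x) (fun t x => -wzz t x) :=
  ⟨h.c0.neg, h.ct.neg, h.c1.neg, h.c2.neg, fun t x => (h.ht t x).neg,
    fun t x => (h.hx t x).neg, fun t x => (h.hxx t x).neg⟩

lemma second_deriv_nonneg {f f' : ℝ → ℝ} {f'' x : ℝ} (h : ∀ y, HasDerivAt f (f' y) y) (h2 : HasDerivAt f' f'' x)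
    (hm : IsLocalMin f x) : 0 ≤ f'' := by
  by_contra hneg
  push Not at hneg
  have e0 : deriv f = f' := funext fun y => (h y).deriv
  have h0 : f' x = 0 := hm.hasDerivAt_eq_zero (h x)
  have hn : deriv (-f) = -f' := funext fun y => ((h y).neg).deriv
  have hmax : IsLocalMin (-f) x := by
    refine isLocalMin_of_deriv_deriv_pos ?_ ?_ ?_
    · rw [hn, (h2.neg).deriv]; linarith
    · rw [hn]; simp [h0]
    · exact (h x).neg.continuousAt
  have hc : f =ᶠ[nhds x] fun _ => f x := by
    filter_upwards [hm, hmax] with y h1 h2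
    simp only [Pi.neg_apply] at h2
    linarith
  have hc2 : f' =ᶠ[nhds x] fun _ => 0 := by
    have := hc.eventuallyEq_nhds
    filter_upwards [this] with y hy
    have := (h y).congr_of_eventuallyEq hy.symm
    exact this.unique (hasDerivAt_const _ _)
  have := (h2.congr_of_eventuallyEq hc2.symm).unique (hasDerivAt_const _ _)
  linarith

lemma MP {w wt wz wzz : ℝ → ℝ → ℝ} (h : WS w wt wz wzz) {K : Set (ℝ × ℝ)} (hK : IsCompact K) {C : ℝ}
    (hh : ∀ s x, (s, x) ∈ K → w s x < 0 → (∃ η > 0, ∀ s', s - η < s' → s' ≤ s → (s', x) ∈ K) ∧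
      (∃ η > 0, ∀ x', |x' - x| < η → (s, x') ∈ K) ∧
      ∃ A B c : ℝ, 0 ≤ A ∧ c ≤ C ∧ A * wzz s x + B * wz s x + c * w s x ≤ wt s x) :
    ∀ s x, (s, x) ∈ K → 0 ≤ w s x := by
  intro s1 x1 hs1
  by_contra hneg
  push Not at hneg
  let v : ℝ × ℝ → ℝ := fun p => Real.exp (-(C+1) * p.1) * w p.1 p.2
  have cv : Continuous v := by have := h.c0; simp only [v]; fun_prop
  obtain ⟨⟨s, x⟩, hp, hmin⟩ := hK.exists_isMinOn ⟨_, hs1⟩ cv.continuousOn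
  have hmin' : ∀ p ∈ K, v (s, x) ≤ v p := fun p hp => hmin hp
  have e1 : v (s1, x1) < 0 := mul_neg_of_pos_of_neg (Real.exp_pos _) hneg
  have e2 : v (s, x) < 0 := (hmin' _ hs1).trans_lt e1
  have ep := Real.exp_pos (-(C+1) * s)
  have hw : w s x < 0 := by
    simp only [v] at e2
    by_contra hcon
    push Not at hcon
    nlinarith [mul_nonneg ep.le hcon]
  obtain ⟨⟨η1, hη1, H1⟩, ⟨η2, hη2, H2⟩, A, B, c, hA, hc, hle⟩ := hh s x hp hw
  have hloc : IsLocalMin (w s) x := by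
    have : ∀ᶠ x' in nhds x, |x' - x| < η2 := by
      have := Metric.ball_mem_nhds x hη2
      filter_upwards [this] with y hy
      simpa [Real.dist_eq] using hy
    filter_upwards [this] with y hy
    have := hmin' _ (H2 y hy)
    simp only [v] at this
    exact le_of_mul_le_mul_left this ep
  have d1 : wz s x = 0 := hloc.hasDerivAt_eq_zero (h.hx s x)
  have d2 : 0 ≤ wzz s x := second_deriv_nonneg (h.hx s) (h.hxx s x) hloc
  -- time derivative
  have d3 : wt s x ≤ (C + 1) * w s x := by
    have dv : HasDerivAt (fun s' => v (s', x)) (Real.exp (-(C+1) * s) * (-(C+1)) * w s x + Real.exp (-(C+1) * s) * wt s x) s := by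
      have := (((hasDerivAt_id s).const_mul (-(C+1))).exp).mul (h.ht s x)
      refine this.congr_deriv ?_
      simp
    have hle0 : Real.exp (-(C+1) * s) * (-(C+1)) * w s x + Real.exp (-(C+1) * s) * wt s x ≤ 0 := by
      have dw := dv.hasDerivWithinAt (s := Iic s)
      have ht := hasDerivWithinAt_iff_tendsto_slope.1 dw
      rw [Iic_sdiff_right] at ht
      refine le_of_tendsto ht ?_
      have m1 : Ioi (s - η1) ∈ nhdsWithin s (Iio s) := mem_nhdsWithin_of_mem_nhds (Ioi_mem_nhds (by linarith))
      filter_upwards [m1, self_mem_nhdsWithin] with y hy1 hys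
      have hys : y < s := hys
      have := hmin' _ (H1 y hy1 hys.le)
      rw [slope_def_field]
      exact div_nonpos_of_nonneg_of_nonpos (by linarith) (by linarith)
    have : Real.exp (-(C+1) * s) * (wt s x - (C+1) * w s x) ≤ 0 := by linarith
    have := nonpos_of_mul_nonpos_right this ep
    linarith
  rw [d1] at hle
  nlinarith [mul_nonneg hA d2, mul_nonneg_of_nonpos_of_nonpos (sub_nonpos.2 hc) hw.le]

structure PS (a b c u ut ux uxx : ℝ → ℝ → ℝ) : Prop where
  ws : WS u ut ux uxx
  ca : Continuous (fun p : ℝ × ℝ => a p.1 p.2)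
  cb : Continuous (fun p : ℝ × ℝ => b p.1 p.2)
  cc : Continuous (fun p : ℝ × ℝ => c p.1 p.2)
  apos : ∀ t x, 0 < a t x
  eq : ∀ t x, ut t x = a t x * uxx t x + b t x * ux t x + c t x * u t x
  hU : ∀ t {l m : ℝ}, l < m → ∃ x ∈ Ioo l m, u t x ≠ 0

lemma PS.neg {a b c u ut ux uxx : ℝ → ℝ → ℝ} (h : PS a b c u ut ux uxx) :
    PS a b c (fun t x => -u t x) (fun t x => -ut t x) (fun t x => -ux t x) (fun t x => -uxx t x) :=
  ⟨h.ws.neg, h.ca, h.cb, h.cc, h.apos, fun t x => by rw [h.eq]; ring, fun t l m hlm => by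
    obtain ⟨x, hx, hne⟩ := h.hU t hlm
    exact ⟨x, hx, neg_ne_zero.2 hne⟩⟩

lemma PS.refl {a b c u ut ux uxx : ℝ → ℝ → ℝ} (h : PS a b c u ut ux uxx) :
    PS (fun t x => a t (-x)) (fun t x => -b t (-x)) (fun t x => c t (-x)) (fun t x => u t (-x)) (fun t x => ut t (-x)) 
      (fun t x => -ux t (-x)) (fun t x => uxx t (-x)) := by
  have cm : Continuous (fun p : ℝ × ℝ => (p.1, -p.2)) := by fun_prop
  refine ⟨⟨h.ws.c0.comp cm, h.ws.ct.comp cm, (h.ws.c1.comp cm).neg, h.ws.c2.comp cm, fun t x => h.ws.ht t (-x), ?_, ?_⟩,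
    h.ca.comp cm, (h.cb.comp cm).neg, h.cc.comp cm, fun t x => h.apos t (-x), fun t x => by rw [h.eq]; ring, ?_⟩
  · intro t x
    have := (h.ws.hx t (-x)).comp x (hasDerivAt_neg x)
    refine this.congr_deriv (by ring)
  · intro t x
    have := ((h.ws.hxx t (-x)).comp x (hasDerivAt_neg x)).neg
    refine this.congr_deriv (by ring)
  · intro t l m hlm
    obtain ⟨x, hx, hne⟩ := h.hU t (neg_lt_neg hlm)
    exact ⟨-x, ⟨by linarith [hx.2], by linarith [hx.1]⟩, by simpa using hne⟩

lemma cont_bound {c : ℝ → ℝ → ℝ} (cc : Continuous (fun p : ℝ × ℝ => c p.1 p.2)) (s t l r : ℝ) :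
    ∃ C, 0 ≤ C ∧ ∀ s' ∈ Icc s t, ∀ x ∈ Icc l r, |c s' x| ≤ C := by
  obtain ⟨K, hK⟩ := ((isCompact_Icc (a := s) (b := t)).prod (isCompact_Icc (a := l) (b := r))).exists_bound_of_continuousOn
    cc.continuousOn
  exact ⟨max K 0, le_max_right _ _, fun s' h1 x h2 => (hK (s', x) ⟨h1, h2⟩).trans (le_max_left _ _)⟩

/-- strict positivity on a rectangle -/
lemma PS.pos {a b c u ut ux uxx : ℝ → ℝ → ℝ} (h : PS a b c u ut ux uxx) {s t l r : ℝ} (hst : s ≤ t) (hlr : l < r)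
    (h0 : ∀ x ∈ Icc l r, 0 < u s x) (hl : ∀ s' ∈ Icc s t, 0 < u s' l) (hr : ∀ s' ∈ Icc s t, 0 < u s' r) :
    ∀ x ∈ Icc l r, 0 < u t x := by
  have cu := h.ws.c0
  obtain ⟨C, hC0, hC⟩ := cont_bound h.cc s t l r
  obtain ⟨κ, hκ, k0, kl, kr⟩ : ∃ κ > 0, (∀ x ∈ Icc l r, κ ≤ u s x) ∧ (∀ s' ∈ Icc s t, κ ≤ u s' l) ∧ (∀ s' ∈ Icc s t, κ ≤ u s' r) := by
    obtain ⟨p1, q1, m1⟩ := isCompact_Icc.exists_isMinOn (nonempty_Icc.2 hlr.le) (cu.comp (by fun_prop : Continuous (fun x : ℝ => (s, x)))).continuousOn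
    obtain ⟨p2, q2, m2⟩ := isCompact_Icc.exists_isMinOn (nonempty_Icc.2 hst) (cu.comp (by fun_prop : Continuous (fun x : ℝ => (x, l)))).continuousOn
    obtain ⟨p3, q3, m3⟩ := isCompact_Icc.exists_isMinOn (nonempty_Icc.2 hst) (cu.comp (by fun_prop : Continuous (fun x : ℝ => (x, r)))).continuousOn
    refine ⟨min (u s p1) (min (u p2 l) (u p3 r)), ?_, ?_, ?_, ?_⟩
    · exact lt_min (h0 _ q1) (lt_min (hl _ q2) (hr _ q3))
    · exact fun x hx => (min_le_left _ _).trans (m1 hx)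
    · exact fun x hx => (min_le_right _ _).trans ((min_le_left _ _).trans (m2 hx))
    · exact fun x hx => (min_le_right _ _).trans ((min_le_right _ _).trans (m3 hx))
  have wv : WS (fun s' _ => κ * Real.exp (-C * (s' - s))) (fun s' _ => κ * (Real.exp (-C * (s' - s)) * (-C))) (fun _ _ => 0) (fun _ _ => 0) := by
    refine ⟨by fun_prop, by fun_prop, by fun_prop, by fun_prop, ?_, fun _ _ => hasDerivAt_const _ _, fun _ _ => hasDerivAt_const _ _⟩
    intro t x
    have := ((((hasDerivAt_id t).sub_const s).const_mul (-C)).exp).const_mul κ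
    refine this.congr_deriv ?_
    simp
  have key := MP (h.ws.sub wv) (K := Icc s t ×ˢ Icc l r) (isCompact_Icc.prod isCompact_Icc) (C := C) ?_
  · intro x hx
    have := key t x ⟨⟨hst, le_rfl⟩, hx⟩
    have : 0 < κ * Real.exp (-C * (t - s)) := by positivity
    linarith
  · rintro s' x ⟨hs', hx⟩ hneg
    simp only at hs' hx hneg
    have e1 : Real.exp (-C * (s' - s)) ≤ 1 := Real.exp_le_one_iff.2 (by nlinarith [hs'.1])
    have e0 := Real.exp_pos (-C * (s' - s))
    have e2 : κ * Real.exp (-C * (s' - s)) ≤ κ := by nlinarith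
    have n1 : s ≠ s' := by rintro rfl; linarith [k0 x hx]
    have n2 : l ≠ x := by rintro rfl; linarith [kl s' hs']
    have n3 : x ≠ r := by rintro rfl; linarith [kr s' hs']
    have l1 := lt_of_le_of_ne hs'.1 n1
    have l2 := lt_of_le_of_ne hx.1 n2
    have l3 := lt_of_le_of_ne hx.2 n3
    refine ⟨⟨s' - s, by linarith, fun y h1 h2 => ⟨⟨by linarith, h2.trans hs'.2⟩, hx⟩⟩,
      ⟨min (x - l) (r - x), lt_min (by linarith) (by linarith), fun y hy => ?_⟩, a s' x, b s' x, c s' x, (h.apos _ _).le, 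
        (le_abs_self _).trans (hC s' hs' x hx), ?_⟩
    · obtain ⟨h1, h2⟩ := lt_min_iff.1 hy
      rw [abs_lt] at h1 h2
      exact ⟨hs', by linarith, by linarith⟩
    · rw [h.eq]
      have := neg_le_of_abs_le (hC s' hs' x hx)
      have : 0 ≤ κ * Real.exp (-C * (s' - s)) * (C + c s' x) := by
        have : 0 ≤ C + c s' x := by linarith
        positivity
      linarith

/-- backward persistence of zeros -/
lemma PS.bp {a b c u ut ux uxx : ℝ → ℝ → ℝ} (h : PS a b c u ut ux uxx) {t x ε : ℝ} (hz : u t x = 0) (hε : 0 < ε) :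
    ∃ η > 0, ∀ t', t - η < t' → t' ≤ t → ∃ x', |x' - x| < ε ∧ u t' x' = 0 := by
  have cu := h.ws.c0
  obtain ⟨l, hl, nl⟩ := h.hU t (show x - ε < x by linarith)
  obtain ⟨r, hr, nr⟩ := h.hU t (show x < x + ε by linarith)
  have cl : Continuous (fun s => u s l) := cu.comp (by fun_prop : Continuous (fun x : ℝ => (x, l)))
  have cr : Continuous (fun s => u s r) := cu.comp (by fun_prop : Continuous (fun x : ℝ => (x, r)))
  have el : ∀ᶠ s in nhds t, u s l ≠ 0 := cl.continuousAt.eventually_ne nl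
  have er : ∀ᶠ s in nhds t, u s r ≠ 0 := cr.continuousAt.eventually_ne nr
  obtain ⟨η, hη, H⟩ := Metric.eventually_nhds_iff_ball.1 (el.and er)
  refine ⟨η, hη, fun t' h1 h2 => ?_⟩
  by_contra hcon
  push Not at hcon
  have hI : ∀ y ∈ Icc l r, |y - x| < ε := fun y hy => abs_lt.2 ⟨by linarith [hy.1, hl.1], by linarith [hy.2, hr.2]⟩
  have hb : ∀ s ∈ Icc t' t, s ∈ Metric.ball t η := fun s hs => by
    rw [Metric.mem_ball, Real.dist_eq, abs_lt]; constructor <;> linarith [hs.1, hs.2]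
  have hlr : l < r := hl.2.trans hr.1
  have sgn : ∀ {f : ℝ → ℝ} {p q : ℝ}, Continuous f → p ≤ q → (∀ y ∈ Icc p q, f y ≠ 0) → 0 < f p → ∀ y ∈ Icc p q, 0 < f y := by
    intro f p q cf hpq hne hp y hy
    by_contra hy0
    push Not at hy0
    obtain ⟨z, hz, e⟩ := intermediate_value_Icc' hy.1 cf.continuousOn (show (0:ℝ) ∈ Icc (f y) (f p) from ⟨hy0, hp.le⟩)
    exact hne z ⟨hz.1, hz.2.trans hy.2⟩ e
  have main : ∀ {a b c u ut ux uxx : ℝ → ℝ → ℝ} (h : PS a b c u ut ux uxx), u t x = 0 → (∀ y ∈ Icc l r, u t' y ≠ 0) → 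
      (∀ s ∈ Icc t' t, u s l ≠ 0) → (∀ s ∈ Icc t' t, u s r ≠ 0) → 0 < u t' l → False := by
    intro a b c u ut ux uxx h hz h0 hl0 hr0 hpos
    have cu := h.ws.c0
    have p0 := sgn (cu.comp (by fun_prop : Continuous (fun x : ℝ => (t', x)))) hlr.le h0 hpos
    have pl := sgn (cu.comp (by fun_prop : Continuous (fun x : ℝ => (x, l)))) h2 hl0 hpos
    have pr := sgn (cu.comp (by fun_prop : Continuous (fun x : ℝ => (x, r)))) h2 hr0 (p0 r ⟨hlr.le, le_rfl⟩)
    have := h.pos h2 hlr p0 pl pr x ⟨hl.2.le, hr.1.le⟩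
    linarith
  have n0 : ∀ y ∈ Icc l r, u t' y ≠ 0 := fun y hy => hcon y (hI y hy)
  have nl' : ∀ s ∈ Icc t' t, u s l ≠ 0 := fun s hs => (H s (hb s hs)).1
  have nr' : ∀ s ∈ Icc t' t, u s r ≠ 0 := fun s hs => (H s (hb s hs)).2
  rcases lt_or_gt_of_ne (n0 l ⟨le_rfl, hlr.le⟩) with hlt | hgt
  · refine main h.neg (by simp [hz]) ?_ ?_ ?_ (by simpa using hlt)
    · simpa using n0
    · simpa using nl'
    · simpa using nr'
  · exact main h hz n0 nl' nr' hgt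


lemma PS.claimA {a b c u ut ux uxx : ℝ → ℝ → ℝ} (h : PS a b c u ut ux uxx) {s t l r x0 x : ℝ} (hst : s ≤ t)
    (hl : ∀ s' ∈ Icc s t, 0 < u s' l) (hr : ∀ s' ∈ Icc s t, u s' r < 0)
    (h0 : ∀ y ∈ Icc l r, ∀ z ∈ Icc l r, u s y = 0 → y ≤ z → u s z ≤ 0)
    (hz : u t x0 = 0) (h1 : l ≤ x0) (h2 : x0 ≤ x) (h3 : x ≤ r) : u t x ≤ 0 := by
  have cu := h.ws.c0
  obtain ⟨C, hC0, hC⟩ := cont_bound h.cc s t l r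
  let K3 : Set (ℝ × ℝ × ℝ) := (Icc s t ×ˢ Icc l r ×ˢ Icc l r) ∩ {p | u p.1 p.2.2 = 0 ∧ p.2.2 ≤ p.2.1}
  have hK3 : IsCompact K3 := by
    refine (isCompact_Icc.prod (isCompact_Icc.prod isCompact_Icc)).inter_right ?_
    refine (isClosed_eq (cu.comp (by fun_prop : Continuous (fun p : ℝ × ℝ × ℝ => (p.1, p.2.2)))) continuous_const).inter
      (isClosed_le (continuous_snd.comp continuous_snd) (continuous_fst.comp continuous_snd))
  let K : Set (ℝ × ℝ) := (fun p : ℝ × ℝ × ℝ => (p.1, p.2.1)) '' K3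
  have hK : IsCompact K := hK3.image (by fun_prop)
  have mK : ∀ s' x y, s' ∈ Icc s t → x ∈ Icc l r → y ∈ Icc l r → u s' y = 0 → y ≤ x → (s', x) ∈ K :=
    fun s' x y q1 q2 q3 q4 q5 => ⟨(s', x, y), ⟨⟨q1, q2, q3⟩, q4, q5⟩, rfl⟩
  have key := MP h.ws.neg hK (C := C) ?_
  · have := key t x (mK t x x0 ⟨hst, le_rfl⟩ ⟨h1.trans h2, h3⟩ ⟨h1, h2.trans h3⟩ hz h2)
    linarith
  · rintro s' x' ⟨⟨s'', x'', y⟩, ⟨⟨q1, q2, q3⟩, q4, q5⟩, hh⟩ hneg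
    simp only [Prod.mk.injEq] at hh
    obtain ⟨rfl, rfl⟩ := hh
    simp only at q1 q2 q3 q4 q5 hneg
    have n1 : s ≠ s'' := by rintro rfl; have := h0 y q3 x'' q2 q4 q5; linarith
    have n2 : y ≠ x'' := by rintro rfl; linarith
    have n3 : x'' ≠ r := by rintro rfl; linarith [hr s'' q1]
    have n4 : l ≠ y := by rintro rfl; linarith [hl s'' q1]
    have l1 := lt_of_le_of_ne q1.1 n1
    have l2 := lt_of_le_of_ne q5 n2
    have l3 := lt_of_le_of_ne q2.2 n3
    have l4 := lt_of_le_of_ne q3.1 n4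
    refine ⟨?_, ?_, a s'' x'', b s'' x'', c s'' x'', (h.apos _ _).le, (le_abs_self _).trans (hC s'' q1 x'' q2), ?_⟩
    · obtain ⟨η, hη, H⟩ := h.bp q4 (ε := min (x'' - y) (y - l)) (lt_min (by linarith) (by linarith))
      refine ⟨min η (s'' - s), lt_min hη (by linarith), fun s' r1 r2 => ?_⟩
      have r3 := min_le_left η (s'' - s)
      have r4 := min_le_right η (s'' - s)
      obtain ⟨y', hy', hz'⟩ := H s' (by linarith) r2
      obtain ⟨i1, i2⟩ := lt_min_iff.1 hy'
      rw [abs_lt] at i1 i2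
      exact mK s' x'' y' ⟨by linarith, r2.trans q1.2⟩ q2 ⟨by linarith, by linarith [q2.2]⟩ hz' (by linarith)
    · refine ⟨min (x'' - y) (r - x''), lt_min (by linarith) (by linarith), fun z hz => ?_⟩
      obtain ⟨i1, i2⟩ := lt_min_iff.1 hz
      rw [abs_lt] at i1 i2
      exact mK s'' z y q1 ⟨by linarith, by linarith⟩ q3 q4 (by linarith)
    · rw [h.eq]; linarith

/-- sign change case -/
lemma PS.one_zero {a b c u ut ux uxx : ℝ → ℝ → ℝ} (h : PS a b c u ut ux uxx) {s t l r x0 : ℝ} (hst : s ≤ t)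
    (hl : ∀ s' ∈ Icc s t, 0 < u s' l) (hr : ∀ s' ∈ Icc s t, u s' r < 0)
    (hp : ∀ x, l ≤ x → x < x0 → 0 < u s x) (hn : ∀ x, x0 < x → x ≤ r → u s x < 0) (hz : u s x0 = 0) {x1 x2 : ℝ}
    (h1 : l ≤ x1) (h12 : x1 < x2) (h2 : x2 ≤ r) (z1 : u t x1 = 0) (z2 : u t x2 = 0) : False := by
  obtain ⟨y, hy, hne⟩ := h.hU t h12
  have e : ∀ x ∈ Icc l r, u s x = 0 → x = x0 := by
    intro x hx hx0
    rcases lt_trichotomy x x0 with q | q | q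
    · linarith [hp x hx.1 q]
    · exact q
    · linarith [hn x q hx.2]
  have i1 : u t y ≤ 0 := by
    refine h.claimA hst hl hr ?_ z1 h1 hy.1.le (by linarith [hy.2])
    intro y1 m1 y2 m2 q hle
    rw [e y1 m1 q] at hle
    rcases hle.eq_or_lt with q | q
    · rw [← q, hz]
    · exact (hn y2 q m2.2).le
  have i2 : -u t (- -y) ≤ 0 := by
    refine h.refl.neg.claimA (l := -r) (r := -l) (x0 := -x2) (x := -y) hst ?_ ?_ ?_ (by simpa using z2) (by linarith) (by linarith [hy.2]) (by linarith [hy.1])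
    · intro s' hs'; simpa using hr s' hs'
    · intro s' hs'; simpa using hl s' hs'
    · intro y1 m1 y2 m2 q hle
      have := e (-y1) ⟨by linarith [m1.2], by linarith [m1.1]⟩ (by simpa using q)
      have hle' : -y2 ≤ x0 := by linarith
      rcases hle'.eq_or_lt with q | q
      · simp only [q, hz]; simp
      · have := hp (-y2) (by linarith [m2.2]) q
        linarith
  rw [neg_neg] at i2
  exact hne (by linarith)

/-- touching case -/
lemma PS.touch {a b c u ut ux uxx : ℝ → ℝ → ℝ} (h : PS a b c u ut ux uxx) {s t x0 ε δ B C : ℝ} (hst : s < t) (hε : 0 < ε)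
    (hδ : 0 < δ) (ha : ∀ s' ∈ Icc s t, ∀ x ∈ Icc (x0 - ε) (x0 + ε), δ ≤ a s' x)
    (hB : ∀ s' ∈ Icc s t, ∀ x ∈ Icc (x0 - ε) (x0 + ε), |b s' x| ≤ B)
    (hC : ∀ s' ∈ Icc s t, ∀ x ∈ Icc (x0 - ε) (x0 + ε), |c s' x| ≤ C)
    (hsmall : 2 * B * ε + C * (2 * ε^2 + δ * (t - s)) ≤ δ)
    (hl : ∀ s' ∈ Icc s t, 0 < u s' (x0 - ε)) (hr : ∀ s' ∈ Icc s t, 0 < u s' (x0 + ε))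
    (hp : ∀ x ∈ Icc (x0 - ε) (x0 + ε), x ≠ x0 → 0 < u s x) (hz : u s x0 = 0) :
    ∀ x ∈ Icc (x0 - ε) (x0 + ε), 0 < u t x := by
  intro x1 hx1
  have cu := h.ws.c0
  have hC0 : 0 ≤ C := (abs_nonneg _).trans (hC s ⟨le_rfl, hst.le⟩ x0 ⟨by linarith, by linarith⟩)
  obtain ⟨θ, hθ, hθε, hθ2⟩ : ∃ θ > 0, θ ≤ ε ∧ θ^2 < δ * (t - s) := by
    have hq : 0 < δ * (t - s) := mul_pos hδ (by linarith)
    refine ⟨min ε (√(δ * (t - s)) / 2), lt_min hε (by positivity), min_le_left _ _, ?_⟩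
    have i1 : min ε (√(δ * (t - s)) / 2) ≤ √(δ * (t - s)) / 2 := min_le_right _ _
    have i2 : 0 ≤ min ε (√(δ * (t - s)) / 2) := by positivity
    have i3 := Real.sq_sqrt hq.le
    nlinarith [sq_nonneg (√(δ * (t - s)))]
  -- lower bound of u
  set Q := ε^2 + δ * (t - s) with hQ
  have hQ0 : 0 < Q := by have : 0 < t - s := by linarith
                         positivity
  obtain ⟨κ, hκ, k0, kl, kr⟩ : ∃ κ > 0, (∀ x ∈ Icc (x0-ε) (x0-θ) ∪ Icc (x0+θ) (x0+ε), κ ≤ u s x) ∧ (∀ s' ∈ Icc s t, κ ≤ u s' (x0-ε)) ∧ (∀ s' ∈ Icc s t, κ ≤ u s' (x0+ε)) := by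
    obtain ⟨p1, q1, m1⟩ := (isCompact_Icc.union isCompact_Icc).exists_isMinOn (s := Icc (x0-ε) (x0-θ) ∪ Icc (x0+θ) (x0+ε)) ⟨x0 - ε, Or.inl ⟨le_rfl, by linarith⟩⟩ (cu.comp (by fun_prop : Continuous (fun x : ℝ => (s, x)))).continuousOn
    obtain ⟨p2, q2, m2⟩ := isCompact_Icc.exists_isMinOn (nonempty_Icc.2 hst.le) (cu.comp (by fun_prop : Continuous (fun x : ℝ => (x, x0-ε)))).continuousOn
    obtain ⟨p3, q3, m3⟩ := isCompact_Icc.exists_isMinOn (nonempty_Icc.2 hst.le) (cu.comp (by fun_prop : Continuous (fun x : ℝ => (x, x0+ε)))).continuousOn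
    refine ⟨min (u s p1) (min (u p2 (x0-ε)) (u p3 (x0+ε))), ?_, ?_, ?_, ?_⟩
    · refine lt_min ?_ (lt_min (hl _ q2) (hr _ q3))
      rcases q1 with q | q
      · exact hp p1 ⟨q.1, by linarith [q.2]⟩ (by have := q.2; intro e; linarith)
      · exact hp p1 ⟨by linarith [q.1], q.2⟩ (by have := q.1; intro e; linarith)
    · exact fun x hx => (min_le_left _ _).trans (m1 hx)
    · exact fun x hx => (min_le_right _ _).trans ((min_le_left _ _).trans (m2 hx))
    · exact fun x hx => (min_le_right _ _).trans ((min_le_right _ _).trans (m3 hx))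
  set k := κ / Q with hk
  have hk0 : 0 < k := by positivity
  have hkQ : k * Q = κ := by rw [hk]; field_simp
  have wv : WS (fun s' x => k * ((x - x0)^2 - θ^2 + δ * (s' - s))) (fun _ _ => k * δ) (fun _ x => k * (2 * (x - x0))) (fun _ _ => k * 2) := by
    refine ⟨by fun_prop, by fun_prop, by fun_prop, by fun_prop, ?_, ?_, ?_⟩
    · intro t x
      have := (((((hasDerivAt_id t).sub_const s).const_mul δ)).const_add ((x - x0)^2 - θ^2)).const_mul k
      refine this.congr_deriv (by simp)
    · intro t x
      have := ((((((hasDerivAt_id x).sub_const x0).pow 2)).sub_const (θ^2)).add_const (δ * (t - s))).const_mul k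
      refine this.congr_deriv (by simp)
    · intro t x
      have := ((((hasDerivAt_id x).sub_const x0).const_mul 2)).const_mul k
      refine this.congr_deriv (by simp)
  have key := MP (h.ws.sub wv) (K := Icc s t ×ˢ Icc (x0-ε) (x0+ε)) (isCompact_Icc.prod isCompact_Icc) (C := C) ?_
  · have := key t x1 ⟨⟨hst.le, le_rfl⟩, hx1⟩
    have : 0 < k * ((x1 - x0)^2 - θ^2 + δ * (t - s)) := by
      apply mul_pos hk0; nlinarith [sq_nonneg (x1 - x0)]
    linarith
  · rintro s' x ⟨hs', hx⟩ hneg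
    simp only at hs' hx hneg
    have hxa : |x - x0| ≤ ε := abs_le.2 ⟨by linarith [hx.1], by linarith [hx.2]⟩
    have hx2 : (x - x0)^2 ≤ ε^2 := by rw [← sq_abs]; gcongr
    have hs2 : δ * (s' - s) ≤ δ * (t - s) := by have := hs'.2; gcongr
    have hs3 : 0 ≤ δ * (s' - s) := mul_nonneg hδ.le (by linarith [hs'.1])
    have e2 : k * ((x - x0)^2 - θ^2 + δ * (s' - s)) ≤ κ := by
      rw [← hkQ]
      apply mul_le_mul_of_nonneg_left _ hk0.le
      nlinarith [sq_nonneg θ]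
    have n1 : s ≠ s' := by
      rintro rfl
      by_cases hxθ : |x - x0| < θ
      · have u0 : 0 ≤ u s x := by
          by_cases e : x = x0
          · rw [e, hz]
          · exact (hp x hx e).le
        have : (x - x0)^2 ≤ θ^2 := by rw [← sq_abs]; gcongr
        have : k * ((x - x0)^2 - θ^2 + δ * (s - s)) ≤ 0 := by
          apply mul_nonpos_of_nonneg_of_nonpos hk0.le; linarith
        linarith
      · push Not at hxθ
        have : κ ≤ u s x := by
          apply k0
          rcases le_abs.1 hxθ with q | q
          · right; exact ⟨by linarith, hx.2⟩
          · left; exact ⟨hx.1, by linarith⟩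
        linarith
    have n2 : x0 - ε ≠ x := by rintro rfl; linarith [kl s' hs']
    have n3 : x ≠ x0 + ε := by rintro rfl; linarith [kr s' hs']
    have l1 := lt_of_le_of_ne hs'.1 n1
    have l2 := lt_of_le_of_ne hx.1 n2
    have l3 := lt_of_le_of_ne hx.2 n3
    refine ⟨⟨s' - s, by linarith, fun y h1 h2 => ⟨⟨by linarith, h2.trans hs'.2⟩, hx⟩⟩,
      ⟨min (x - (x0 - ε)) (x0 + ε - x), lt_min (by linarith) (by linarith), fun y hy => ?_⟩, a s' x, b s' x, c s' x, (h.apos _ _).le, 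
        (le_abs_self _).trans (hC s' hs' x hx), ?_⟩
    · obtain ⟨h1, h2⟩ := lt_min_iff.1 hy
      rw [abs_lt] at h1 h2
      exact ⟨hs', by linarith, by linarith⟩
    · rw [h.eq]
      have b1 : -(B * ε) ≤ b s' x * (x - x0) := by
        have := abs_mul (b s' x) (x - x0)
        have := neg_abs_le (b s' x * (x - x0))
        have : |b s' x| * |x - x0| ≤ B * ε := mul_le_mul (hB s' hs' x hx) hxa (abs_nonneg _) ((abs_nonneg _).trans (hB s' hs' x hx))
        linarith
      have c1 : -(C * (2 * ε^2 + δ * (t - s))) ≤ c s' x * ((x - x0)^2 - θ^2 + δ * (s' - s)) := by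
        have := abs_mul (c s' x) ((x - x0)^2 - θ^2 + δ * (s' - s))
        have := neg_abs_le (c s' x * ((x - x0)^2 - θ^2 + δ * (s' - s)))
        have hθs : θ^2 ≤ ε^2 := by gcongr
        have : |(x - x0)^2 - θ^2 + δ * (s' - s)| ≤ 2 * ε^2 + δ * (t - s) := by
          rw [abs_le]; constructor <;> nlinarith [sq_nonneg (x - x0), sq_nonneg θ]
        have : |c s' x| * |(x - x0)^2 - θ^2 + δ * (s' - s)| ≤ C * (2 * ε^2 + δ * (t - s)) := mul_le_mul (hC s' hs' x hx) this (abs_nonneg _) hC0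
        linarith
      have a1 := ha s' hs' x hx
      have fin : 0 ≤ k * (a s' x * 2 + b s' x * (x - x0) * 2 + c s' x * ((x - x0)^2 - θ^2 + δ * (s' - s)) - δ) := by
        apply mul_nonneg hk0.le
        linarith
      linarith


lemma PS.near {a b c u ut ux uxx : ℝ → ℝ → ℝ} (h : PS a b c u ut ux uxx) {s y : ℝ} (hy : 0 < u s y) :
    ∃ η > 0, ∀ s' ∈ Icc s (s + η), 0 < u s' y := by
  have cl : Continuous (fun s => u s y) := h.ws.c0.comp (by fun_prop : Continuous (fun x : ℝ => (x, y)))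
  obtain ⟨η, hη, H⟩ := Metric.eventually_nhds_iff.1 (cl.continuousAt.eventually (lt_mem_nhds hy))
  refine ⟨η / 2, by linarith, fun s' hs' => H ?_⟩
  rw [Real.dist_eq, abs_lt]; constructor <;> linarith [hs'.1, hs'.2]

/-- forward: an isolated zero gives at most one zero afterwards (first sign positive on the left) -/
lemma PS.fwd_aux {a b c u ut ux uxx : ℝ → ℝ → ℝ} (h : PS a b c u ut ux uxx) {s x0 e0 : ℝ} (he : 0 < e0) (hz : u s x0 = 0)
    (hiso : ∀ x, x ≠ x0 → |x - x0| ≤ e0 → u s x ≠ 0) (hpos : 0 < u s (x0 - e0)) :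
    ∃ ε > 0, ∃ η > 0, ∀ t ∈ Icc s (s + η), ∀ x1 x2, |x1 - x0| ≤ ε → |x2 - x0| ≤ ε → u t x1 = 0 → u t x2 = 0 → x1 = x2 := by
  have cs : Continuous (u s) := h.ws.c0.comp (by fun_prop : Continuous (fun x : ℝ => (s, x)))
  have pl : ∀ x, x0 - e0 ≤ x → x < x0 → 0 < u s x := by
    intro x h1 h2
    by_contra hcon
    push Not at hcon
    obtain ⟨z, hz, e⟩ := intermediate_value_Icc' h1 cs.continuousOn (show (0:ℝ) ∈ Icc (u s x) (u s (x0 - e0)) from ⟨hcon, hpos.le⟩)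
    refine hiso z (by intro e; linarith [hz.2]) ?_ e
    rw [abs_le]; constructor <;> linarith [hz.1, hz.2]
  obtain ⟨A, hA0, hA⟩ := cont_bound (c := fun s x => 1 / a s x) (continuous_const.div h.ca fun p => (h.apos _ _).ne') s (s+1) (x0 - e0) (x0 + e0)
  obtain ⟨B, hB0, hB⟩ := cont_bound h.cb s (s+1) (x0 - e0) (x0 + e0)
  obtain ⟨C, hC0, hC⟩ := cont_bound h.cc s (s+1) (x0 - e0) (x0 + e0)
  set δ := 1 / (A + 1) with hδ
  have hδ0 : 0 < δ := by positivity
  have hδa : ∀ s' ∈ Icc s (s+1), ∀ x ∈ Icc (x0 - e0) (x0 + e0), δ ≤ a s' x := by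
    intro s' hs' x hx
    have := (le_abs_self _).trans (hA s' hs' x hx)
    have ap := h.apos s' x
    rw [hδ, div_le_iff₀ (by positivity)]
    rw [div_le_iff₀ ap] at this
    nlinarith
  rcases lt_or_gt_of_ne (hiso (x0 + e0) (by intro e; linarith) (by rw [add_sub_cancel_left, abs_of_pos he])) with hlt | hgt
  · -- sign change
    have pr : ∀ x, x0 < x → x ≤ x0 + e0 → u s x < 0 := by
      intro x h1 h2
      by_contra hcon
      push Not at hcon
      obtain ⟨z, hz, e⟩ := intermediate_value_Icc' h2 cs.continuousOn (show (0:ℝ) ∈ Icc (u s (x0 + e0)) (u s x) from ⟨hlt.le, hcon⟩)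
      refine hiso z (by intro e; linarith [hz.1]) ?_ e
      rw [abs_le]; constructor <;> linarith [hz.1, hz.2]
    obtain ⟨η1, hη1, H1⟩ := h.near hpos
    obtain ⟨η2, hη2, H2⟩ := h.neg.near (s := s) (y := x0 + e0) (by linarith)
    refine ⟨e0, he, min η1 η2, lt_min hη1 hη2, ?_⟩
    have key : ∀ t ∈ Icc s (s + min η1 η2), ∀ x1 x2, |x1 - x0| ≤ e0 → |x2 - x0| ≤ e0 → u t x1 = 0 → u t x2 = 0 → ¬ x1 < x2 := by
      intro t ht x1 x2 h1 h2 z1 z2 hlt'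
      rw [abs_le] at h1 h2
      have m1 := min_le_left η1 η2
      have m2 := min_le_right η1 η2
      exact h.one_zero (s := s) (t := t) (l := x0 - e0) (r := x0 + e0) (x0 := x0) ht.1 (fun s' hs' => H1 s' ⟨hs'.1, by linarith [hs'.2, ht.2]⟩)
        (fun s' hs' => by have := H2 s' ⟨hs'.1, by linarith [hs'.2, ht.2]⟩; linarith) pl pr hz (by linarith) hlt' (by linarith) z1 z2
    intro t ht x1 x2 h1 h2 z1 z2
    rcases lt_trichotomy x1 x2 with q | q | q
    · exact (key t ht x1 x2 h1 h2 z1 z2 q).elim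
    · exact q
    · exact (key t ht x2 x1 h2 h1 z2 z1 q).elim
  · -- touching
    have pr : ∀ x, x0 < x → x ≤ x0 + e0 → 0 < u s x := by
      intro x h1 h2
      by_contra hcon
      push Not at hcon
      obtain ⟨z, hz, e⟩ := intermediate_value_Icc h2 cs.continuousOn (show (0:ℝ) ∈ Icc (u s x) (u s (x0 + e0)) from ⟨hcon, hgt.le⟩)
      refine hiso z (by intro e; linarith [hz.1]) ?_ e
      rw [abs_le]; constructor <;> linarith [hz.1, hz.2]
    obtain ⟨ε, hε, hεe, hs1⟩ : ∃ ε > 0, ε ≤ e0 ∧ 2 * B * ε + 2 * C * ε^2 ≤ δ / 2 := by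
      refine ⟨min (min e0 1) (δ / (2 * (2 * B + 2 * C + 1))), lt_min (lt_min he one_pos) (by positivity), (min_le_left _ _).trans (min_le_left _ _), ?_⟩
      set ε := min (min e0 1) (δ / (2 * (2 * B + 2 * C + 1)))
      have e1 : ε ≤ 1 := (min_le_left _ _).trans (min_le_right _ _)
      have e2 : ε ≤ δ / (2 * (2 * B + 2 * C + 1)) := min_le_right _ _
      have e3 : 0 < ε := lt_min (lt_min he one_pos) (by positivity)
      rw [le_div_iff₀ (by positivity)] at e2
      have : C * ε^2 ≤ C * ε := by
        apply mul_le_mul_of_nonneg_left _ hC0; nlinarith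
      nlinarith
    obtain ⟨η1, hη1, H1⟩ := h.near (pl (x0 - ε) (by linarith) (by linarith))
    obtain ⟨η2, hη2, H2⟩ := h.near (pr (x0 + ε) (by linarith) (by linarith))
    set η := min (min η1 η2) (min 1 (1 / (2 * (C + 1)))) with hη
    have hη0 : 0 < η := lt_min (lt_min hη1 hη2) (lt_min one_pos (by positivity))
    have b1 : η ≤ η1 := (min_le_left _ _).trans (min_le_left _ _)
    have b2 : η ≤ η2 := (min_le_left _ _).trans (min_le_right _ _)
    have b3 : η ≤ 1 := (min_le_right _ _).trans (min_le_left _ _)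
    have b4 : η ≤ 1 / (2 * (C + 1)) := (min_le_right _ _).trans (min_le_right _ _)
    have b5 : C * η ≤ 1 / 2 := by
      rw [le_div_iff₀ (by positivity)] at b4
      nlinarith
    refine ⟨ε, hε, η, hη0, ?_⟩
    intro t ht x1 x2 h1 h2 z1 z2
    rcases ht.1.eq_or_lt with q | q
    · subst q
      have e : ∀ x, |x - x0| ≤ ε → u s x = 0 → x = x0 := by
        intro x hx hx0
        by_contra hne
        exact hiso x hne (hx.trans hεe) hx0
      rw [e x1 h1 z1, e x2 h2 z2]
    · exfalso
      have sub : ∀ x ∈ Icc (x0 - ε) (x0 + ε), x ∈ Icc (x0 - e0) (x0 + e0) := fun x hx => ⟨by linarith [hx.1], by linarith [hx.2]⟩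
      have subt : ∀ s' ∈ Icc s t, s' ∈ Icc s (s+1) := fun s' hs' => ⟨hs'.1, by linarith [hs'.2, ht.2]⟩
      have := h.touch (s := s) (t := t) (x0 := x0) (ε := ε) (δ := δ) (B := B) (C := C) q hε hδ0
        (fun s' hs' x hx => hδa s' (subt s' hs') x (sub x hx))
        (fun s' hs' x hx => hB s' (subt s' hs') x (sub x hx))
        (fun s' hs' x hx => hC s' (subt s' hs') x (sub x hx))
        (by
          have : C * (t - s) ≤ 1 / 2 := (mul_le_mul_of_nonneg_left (by linarith [ht.2]) hC0).trans b5
          nlinarith)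
        (fun s' hs' => H1 s' ⟨hs'.1, by linarith [hs'.2, ht.2]⟩)
        (fun s' hs' => H2 s' ⟨hs'.1, by linarith [hs'.2, ht.2]⟩)
        (by
          intro x hx hne
          rcases lt_or_gt_of_ne hne with q | q
          · exact pl x (sub x hx).1 q
          · exact pr x q (sub x hx).2) hz x1
        (by rw [abs_le] at h1; exact ⟨by linarith, by linarith⟩)
      linarith

lemma PS.fwd {a b c u ut ux uxx : ℝ → ℝ → ℝ} (h : PS a b c u ut ux uxx) {s x0 e0 : ℝ} (he : 0 < e0) (hz : u s x0 = 0)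
    (hiso : ∀ x, x ≠ x0 → |x - x0| ≤ e0 → u s x ≠ 0) :
    ∃ ε > 0, ∃ η > 0, ∀ t ∈ Icc s (s + η), ∀ x1 x2, |x1 - x0| ≤ ε → |x2 - x0| ≤ ε → u t x1 = 0 → u t x2 = 0 → x1 = x2 := by
  rcases lt_or_gt_of_ne (hiso (x0 - e0) (by intro e; linarith) (by rw [sub_sub_cancel_left, abs_neg, abs_of_pos he])) with hlt | hgt
  · obtain ⟨ε, hε, η, hη, H⟩ := h.neg.fwd_aux he (by simp [hz]) (fun x h1 h2 => neg_ne_zero.2 (hiso x h1 h2)) (by linarith)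
    refine ⟨ε, hε, η, hη, fun t ht x1 x2 h1 h2 z1 z2 => H t ht x1 x2 h1 h2 (by simp [z1]) (by simp [z2])⟩
  · exact h.fwd_aux he hz hiso hgt


lemma Sol.toPS {a b c a_t a_x u ut ux uxx : ℝ → ℝ → ℝ} (h : Sol a b c a_t a_x u ut ux uxx) :
    PS a b c u ut ux uxx :=
  ⟨⟨h.cu, h.cut, h.cux, h.cuxx, h.dut, h.dux, h.duxx⟩, h.ca, h.cb, h.cc, h.apos, h.eq, fun t _ _ hlm => h.hU t hlm⟩

lemma per_int {f : ℝ → ℝ} (hf : ∀ x, f (x + 2 * π) = f x) (k : ℤ) (x : ℝ) : f (x - k • (2 * π)) = f x :=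
  (show Function.Periodic f (2 * π) from hf).sub_zsmul_eq k

/-- two points of the fundamental domain equal modulo the period -/
lemma eq_of_mod {x y : ℝ} {k : ℤ} (hx : |x - y| < 2 * π) (h : x - y = k • (2 * π)) : x = y := by
  have hp := Real.pi_pos
  have : k = 0 := by
    rw [h, zsmul_eq_mul, abs_mul, abs_of_pos (by positivity : (0:ℝ) < 2 * π)] at hx
    have h1 : |(k:ℝ)| < 1 := by nlinarith
    have h2 : |k| < 1 := by exact_mod_cast h1
    exact Int.abs_lt_one_iff.1 h2
  subst this
  simp at h
  linarith

lemma Sol.back {a b c a_t a_x u ut ux uxx : ℝ → ℝ → ℝ} (h : Sol a b c a_t a_x u ut ux uxx) {t : ℝ} {m : ℕ}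
    (hm : (m : ℕ∞) ≤ zeroNum (u t)) :
    ∃ η > 0, ∀ t', t - η < t' → t' ≤ t → (m : ℕ∞) ≤ zeroNum (u t') := by
  have hp : (0:ℝ) < 2 * π := by have := Real.pi_pos; positivity
  obtain ⟨S, hSs, hSm⟩ := exists_subset_encard_eq hm
  have hfin : S.Finite := by
    rw [← Set.encard_lt_top_iff, hSm]; exact ENat.coe_lt_top m
  obtain ⟨U, hU, hd⟩ := (hfin.image (fun x : ℝ => (x : AddCircle (2 * π)))).t2_separation
  have inj : ∀ x ∈ S, ∀ y ∈ S, (x : AddCircle (2 * π)) = (y : AddCircle (2 * π)) → x = y := by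
    intro x hx y hy hxy
    have hx' := (hSs hx).1
    have hy' := (hSs hy).1
    obtain ⟨k, hk⟩ := (QuotientAddGroup.eq_iff_sub_mem.1 hxy)
    exact eq_of_mod (abs_lt.2 ⟨by linarith [hx'.1, hy'.2], by linarith [hx'.2, hy'.1]⟩) hk.symm
  have key : ∀ x ∈ S, ∃ η > 0, ∀ t', t - η < t' → t' ≤ t → ∃ x', ((x' : ℝ) : AddCircle (2 * π)) ∈ U x ∧ u t' x' = 0 := by
    intro x hx
    have ho : IsOpen {y : ℝ | (y : AddCircle (2 * π)) ∈ U x} :=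
      (hU x).2.preimage (AddCircle.continuous_mk' (2 * π))
    obtain ⟨ε, hε, hb⟩ := Metric.isOpen_iff.1 ho x (hU x).1
    obtain ⟨η, hη, H⟩ := h.toPS.bp (hSs hx).2 hε
    refine ⟨η, hη, fun t' h1 h2 => ?_⟩
    obtain ⟨x', h3, h4⟩ := H t' h1 h2
    exact ⟨x', hb (by rwa [Metric.mem_ball, Real.dist_eq]), h4⟩
  choose! E hE HE using key
  obtain ⟨η, hη, hηE⟩ : ∃ η > 0, ∀ x ∈ S, η ≤ E x := by
    have : ∀ᶠ η in nhdsWithin (0:ℝ) (Ioi 0), ∀ x ∈ S, η ≤ E x := by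
      rw [Filter.eventually_all_finite hfin]
      intro x hx
      exact (eventually_le_nhds (hE x hx)).filter_mono nhdsWithin_le_nhds
    obtain ⟨η, h1, h2⟩ := (this.and self_mem_nhdsWithin).exists
    exact ⟨η, h2, h1⟩
  refine ⟨η, hη, fun t' h1 h2 => ?_⟩
  have : ∀ x ∈ S, ∃ x' : ℝ, ((x' : ℝ) : AddCircle (2 * π)) ∈ U x ∧ u t' x' = 0 :=
    fun x hx => HE x hx t' (by linarith [hηE x hx]) h2
  choose! X hX hX0 using this
  rw [← hSm]
  refine encard_le_encard_of_injOn (f := fun x => toIcoMod hp 0 (X x)) ?_ ?_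
  · intro x hx
    refine ⟨toIcoMod_mem_Ico' hp _, ?_⟩
    show u t' (toIcoMod hp 0 (X x)) = 0
    rw [toIcoMod, per_int (h.pu t')]
    exact hX0 x hx
  · intro x hx y hy hxy
    by_contra hne
    have hne' : (x : AddCircle (2 * π)) ≠ (y : AddCircle (2 * π)) := fun e => hne (inj x hx y hy e)
    have := hd (mem_image_of_mem _ hx) (mem_image_of_mem _ hy) hne'
    refine Set.disjoint_left.1 this (hX x hx) ?_
    have e : ((X x : ℝ) : AddCircle (2 * π)) = (X y : ℝ) := by
      obtain ⟨k, hk⟩ := (toIcoMod_eq_toIcoMod hp (a := 0)).1 hxy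
      refine (QuotientAddGroup.eq_iff_sub_mem.2 ⟨-k, ?_⟩)
      simp only [neg_smul]
      rw [← hk]; ring
    show ((X x : ℝ) : AddCircle (2 * π)) ∈ U y
    rw [e]; exact hX y hy

lemma Sol.forw {a b c a_t a_x u ut ux uxx : ℝ → ℝ → ℝ} (h : Sol a b c a_t a_x u ut ux uxx) {s : ℝ}
    (hm : zeroNum (u s) ≠ ⊤) :
    ∃ η > 0, ∀ t ∈ Icc s (s + η), zeroNum (u t) ≤ zeroNum (u s) := by
  have hpi := Real.pi_gt_three
  have hp : (0:ℝ) < 2 * π := by positivity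
  set S : Set ℝ := {x ∈ Set.Ico (0 : ℝ) (2 * Real.pi) | u s x = 0} with hS
  have hfin : S.Finite := Set.encard_ne_top_iff.1 hm
  have key : ∀ x0 ∈ S, ∃ ε > 0, ∃ η > 0, ∀ t ∈ Icc s (s+η), ∀ x1 x2, |x1-x0| ≤ ε → |x2-x0| ≤ ε →
      u t x1 = 0 → u t x2 = 0 → x1 = x2 := by
    intro x0 hx0
    have hF : {x | |x - x0| ≤ 1 ∧ u s x = 0}.Finite := by
      refine Set.Finite.of_injOn (f := fun x => toIcoMod hp 0 x) (t := S) ?_ ?_ hfin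
      · intro x hx
        refine ⟨toIcoMod_mem_Ico' hp _, ?_⟩
        show u s (toIcoMod hp 0 x) = 0
        rw [toIcoMod, per_int (h.pu s)]
        exact hx.2
      · intro x hx y hy hxy
        obtain ⟨k, hk⟩ := (toIcoMod_eq_toIcoMod hp (a := 0)).1 hxy
        have h1 := abs_le.1 hx.1
        have h2 := abs_le.1 hy.1
        exact (eq_of_mod (abs_lt.2 ⟨by linarith, by linarith⟩) hk).symm
    have hcl : IsClosed ({x | |x - x0| ≤ 1 ∧ u s x = 0} \ {x0}) := (hF.subset diff_subset).isClosed
    obtain ⟨ε, hε, hb⟩ := Metric.isOpen_iff.1 hcl.isOpen_compl x0 (by simp)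
    refine h.toPS.fwd (e0 := min 1 (ε/2)) (lt_min one_pos (by linarith)) hx0.2 ?_
    intro x hne hx hz
    refine hb (show x ∈ Metric.ball x0 ε from ?_) ⟨⟨hx.trans (min_le_left _ _), hz⟩, hne⟩
    rw [Metric.mem_ball, Real.dist_eq]
    linarith [hx.trans (min_le_right _ _)]
  choose! e he E hE H using key
  set U : Set ℝ := ⋃ p ∈ S, ⋃ k : ℤ, Metric.ball (p + k • (2 * π)) (e p) with hUd
  have hUo : IsOpen U := isOpen_biUnion fun p _ => isOpen_iUnion fun k => Metric.isOpen_ball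
  have hK : IsCompact (Icc 0 (2 * π) \ U) := isCompact_Icc.diff hUo
  have ev := hK.eventually_forall_of_forall_eventually (x₀ := s) (P := fun t x => u t x ≠ 0) (by
    intro y hy
    have : u s y ≠ 0 := by
      intro hz
      apply hy.2
      have hmem : toIcoMod hp 0 y ∈ S := by
        refine ⟨toIcoMod_mem_Ico' hp _, ?_⟩
        rw [toIcoMod, per_int (h.pu s)]
        exact hz
      simp only [hUd, mem_iUnion]
      refine ⟨_, hmem, toIcoDiv hp 0 y, ?_⟩
      rw [toIcoMod_add_toIcoDiv_zsmul]
      exact Metric.mem_ball_self (he _ hmem)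
    exact h.cu.continuousAt.eventually_ne this)
  obtain ⟨η0, hη0, hb⟩ := Metric.eventually_nhds_iff.1 ev
  obtain ⟨η, hη, hη1, hηE⟩ : ∃ η > 0, η < η0 ∧ ∀ x ∈ S, η ≤ E x := by
    have : ∀ᶠ η in nhdsWithin (0:ℝ) (Ioi 0), ∀ x ∈ S, η ≤ E x := by
      rw [Filter.eventually_all_finite hfin]
      intro x hx
      exact (eventually_le_nhds (hE x hx)).filter_mono nhdsWithin_le_nhds
    have h3 : ∀ᶠ η in nhdsWithin (0:ℝ) (Ioi 0), η < η0 := 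
      (eventually_lt_nhds hη0).filter_mono nhdsWithin_le_nhds
    obtain ⟨η, ⟨h1, h4⟩, h2⟩ := ((this.and h3).and self_mem_nhdsWithin).exists
    exact ⟨η, h2, h4, h1⟩
  refine ⟨η, hη, fun t ht => ?_⟩
  have near : ∀ y ∈ {x ∈ Set.Ico (0 : ℝ) (2 * Real.pi) | u t x = 0}, ∃ p, p ∈ S ∧ ∃ k : ℤ, |y - k • (2 * π) - p| ≤ e p := by
    intro y hy
    by_contra hcon
    refine hb (y := t) (by rw [Real.dist_eq, abs_of_nonneg] <;> linarith [ht.1, ht.2]) y ⟨⟨hy.1.1, hy.1.2.le⟩, fun hyU => hcon ?_⟩ hy.2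
    simp only [hUd, mem_iUnion] at hyU
    obtain ⟨p, hpS, k, hk⟩ := hyU
    rw [Metric.mem_ball, Real.dist_eq] at hk
    refine ⟨p, hpS, k, ?_⟩
    rw [show y - k • (2 * π) - p = y - (p + k • (2 * π)) by ring]
    exact hk.le
  choose! P hP k hk using near
  refine encard_le_encard_of_injOn (f := P) (fun y hy => hP y hy) ?_
  intro y hy y' hy' hyy
  have h1 := hk y hy
  have h2 := hk y' hy'
  rw [← hyy] at h2
  have h3 := H (P y) (hP y hy) t ⟨ht.1, ht.2.trans (by linarith [hηE _ (hP y hy)])⟩ _ _ h1 h2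
    (by rw [per_int (h.pu t)]; exact hy.2) (by rw [per_int (h.pu t)]; exact hy'.2)
  refine eq_of_mod (k := k y - k y') (abs_lt.2 ⟨by linarith [hy.1.1, hy'.1.2], by linarith [hy.1.2, hy'.1.1]⟩) ?_
  rw [sub_smul]; linarith

lemma Sol.mono {a b c a_t a_x u ut ux uxx : ℝ → ℝ → ℝ} (h : Sol a b c a_t a_x u ut ux uxx) {t1 t2 : ℝ}
    (h12 : t1 ≤ t2) : zeroNum (u t2) ≤ zeroNum (u t1) := by
  by_cases htop : zeroNum (u t1) = ⊤
  · rw [htop]; exact le_top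
  obtain ⟨n, hn⟩ := ENat.ne_top_iff_exists.1 htop
  rw [← hn]
  set A : Set ℝ := {t ∈ Icc t1 t2 | ∀ r ∈ Icc t1 t, zeroNum (u r) ≤ n} with hA
  have h1A : t1 ∈ A := ⟨⟨le_rfl, h12⟩, fun r hr => by rw [le_antisymm hr.2 hr.1, hn]⟩
  have hbd : BddAbove A := ⟨t2, fun t ht => ht.1.2⟩
  set τ := sSup A with hτ
  have l1 : t1 ≤ τ := le_csSup hbd h1A
  have l2 : τ ≤ t2 := csSup_le ⟨_, h1A⟩ fun t ht => ht.1.2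
  have hlt : ∀ r, t1 ≤ r → r < τ → zeroNum (u r) ≤ n := by
    intro r hr hr2
    obtain ⟨t, ht, hrt⟩ := exists_lt_of_lt_csSup ⟨_, h1A⟩ hr2
    exact ht.2 r ⟨hr, hrt.le⟩
  have hτB : zeroNum (u τ) ≤ n := by
    rcases l1.eq_or_lt with e | l
    · rw [← e, hn]
    by_contra hcon
    have : ((n + 1 : ℕ) : ℕ∞) ≤ zeroNum (u τ) := by
      push_cast
      exact Order.add_one_le_of_lt (not_le.1 hcon)
    obtain ⟨η, hη, H⟩ := h.back this
    obtain ⟨r, hr1, hr2⟩ := exists_between (max_lt l (by linarith : τ - η < τ))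
    have h3 := (H r ((le_max_right _ _).trans_lt hr1) hr2.le).trans (hlt r ((le_max_left _ _).trans hr1.le) hr2)
    have : n + 1 ≤ n := by exact_mod_cast h3
    omega
  rcases l2.eq_or_lt with e | l
  · rwa [e] at hτB
  obtain ⟨η, hη, H⟩ := h.forw (s := τ) (ne_top_of_le_ne_top (ENat.coe_ne_top n) hτB)
  have hm : min t2 (τ + η) ∈ A := by
    refine ⟨⟨le_min h12 (by linarith), min_le_left _ _⟩, fun r hr => ?_⟩
    rcases lt_or_ge r τ with hr' | hr'
    · exact hlt r hr.1 hr'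
    · exact (H r ⟨hr', hr.2.trans (min_le_right _ _)⟩).trans hτB
  have := le_csSup hbd hm
  have h5 : τ < min t2 (τ + η) := lt_min l (by linarith)
  exact absurd this (not_le.2 h5)

theorem stmt1
    (δ : ℝ) (hδ : 0 < δ)
    (a b c a_t a_x : ℝ → ℝ → ℝ)
    (φ φ_t φ_x φ_xx : ℝ → ℝ → ℝ)
    (ha_cont : ContinuousOn (fun p : ℝ × ℝ => a p.1 p.2) (Set.Ioi 0 ×ˢ Set.univ))
    (hb_cont : ContinuousOn (fun p : ℝ × ℝ => b p.1 p.2) (Set.Ioi 0 ×ˢ Set.univ))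
    (hc_cont : ContinuousOn (fun p : ℝ × ℝ => c p.1 p.2) (Set.Ioi 0 ×ˢ Set.univ))
    (hat_cont : ContinuousOn (fun p : ℝ × ℝ => a_t p.1 p.2) (Set.Ioi 0 ×ˢ Set.univ))
    (hax_cont : ContinuousOn (fun p : ℝ × ℝ => a_x p.1 p.2) (Set.Ioi 0 ×ˢ Set.univ))
    (ha_t : ∀ t > (0:ℝ), ∀ x : ℝ, HasDerivAt (fun s => a s x) (a_t t x) t)
    (ha_x : ∀ t > (0:ℝ), ∀ x : ℝ, HasDerivAt (fun y => a t y) (a_x t x) x)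
    (M : ℝ)
    (hbound : ∀ t > (0:ℝ), ∀ x : ℝ,
      |a t x| ≤ M ∧ |a_t t x| ≤ M ∧ |a_x t x| ≤ M ∧ |b t x| ≤ M ∧ |c t x| ≤ M)
    (ha_pos : ∀ t > (0:ℝ), ∀ x : ℝ, δ ≤ a t x)
    (ha_per : ∀ t > (0:ℝ), ∀ x : ℝ, a t (x + 2 * Real.pi) = a t x)
    (hb_per : ∀ t > (0:ℝ), ∀ x : ℝ, b t (x + 2 * Real.pi) = b t x)
    (hc_per : ∀ t > (0:ℝ), ∀ x : ℝ, c t (x + 2 * Real.pi) = c t x)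
    (hφ_per : ∀ t > (0:ℝ), ∀ x : ℝ, φ t (x + 2 * Real.pi) = φ t x)
    (hφ_cont : ContinuousOn (fun p : ℝ × ℝ => φ p.1 p.2) (Set.Ioi 0 ×ˢ Set.univ))
    (hφt_cont : ContinuousOn (fun p : ℝ × ℝ => φ_t p.1 p.2) (Set.Ioi 0 ×ˢ Set.univ))
    (hφx_cont : ContinuousOn (fun p : ℝ × ℝ => φ_x p.1 p.2) (Set.Ioi 0 ×ˢ Set.univ))
    (hφxx_cont : ContinuousOn (fun p : ℝ × ℝ => φ_xx p.1 p.2) (Set.Ioi 0 ×ˢ Set.univ))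
    (hφ_t : ∀ t > (0:ℝ), ∀ x : ℝ, HasDerivAt (fun s => φ s x) (φ_t t x) t)
    (hφ_x : ∀ t > (0:ℝ), ∀ x : ℝ, HasDerivAt (fun y => φ t y) (φ_x t x) x)
    (hφ_xx : ∀ t > (0:ℝ), ∀ x : ℝ, HasDerivAt (fun y => φ_x t y) (φ_xx t x) x)
    (heq : ∀ t > (0:ℝ), ∀ x : ℝ,
      φ_t t x = a t x * φ_xx t x + b t x * φ_x t x + c t x * φ t x)
    (hnontriv : ∀ t > (0:ℝ), ∃ x : ℝ, φ t x ≠ 0) :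
    ∀ t₁ t₂ : ℝ, 0 < t₁ → t₁ ≤ t₂ → zeroNum (φ t₂) ≤ zeroNum (φ t₁) := by
  intro t1 t2 h1 h12
  have ce : ∀ {f : ℝ → ℝ → ℝ}, ContinuousOn (fun p : ℝ × ℝ => f p.1 p.2) (Set.Ioi 0 ×ˢ Set.univ) →
      Continuous (fun p : ℝ × ℝ => f (Real.exp p.1) p.2) := by
    intro f hf
    exact hf.comp_continuous (f := fun p : ℝ × ℝ => (Real.exp p.1, p.2)) (by fun_prop)
      (fun p => ⟨Real.exp_pos _, mem_univ _⟩)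
  have cE : Continuous (fun p : ℝ × ℝ => Real.exp p.1) := by fun_prop
  have hS : Sol (fun s x => Real.exp s * a (Real.exp s) x) (fun s x => Real.exp s * b (Real.exp s) x)
      (fun s x => Real.exp s * c (Real.exp s) x)
      (fun s x => Real.exp s * a (Real.exp s) x + Real.exp s * (a_t (Real.exp s) x * Real.exp s))
      (fun s x => Real.exp s * a_x (Real.exp s) x)
      (fun s x => φ (Real.exp s) x) (fun s x => φ_t (Real.exp s) x * Real.exp s)
      (fun s x => φ_x (Real.exp s) x) (fun s x => φ_xx (Real.exp s) x) := by
    have ep := Real.exp_pos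
    refine ⟨cE.mul (ce ha_cont), cE.mul (ce hb_cont), cE.mul (ce hc_cont),
      (cE.mul (ce ha_cont)).add (cE.mul ((ce hat_cont).mul cE)), cE.mul (ce hax_cont), ce hφ_cont,
      (ce hφt_cont).mul cE, ce hφx_cont, ce hφxx_cont, ?_, ?_, ?_, ?_, ?_, ?_, ?_, ?_, ?_, ?_, ?_, ?_⟩
    · intro t x
      exact (Real.hasDerivAt_exp t).mul ((ha_t _ (ep t) x).comp t (Real.hasDerivAt_exp t))
    · intro t x
      exact (ha_x _ (ep t) x).const_mul _
    · intro t x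
      exact (hφ_t _ (ep t) x).comp t (Real.hasDerivAt_exp t)
    · intro t x; exact hφ_x _ (ep t) x
    · intro t x; exact hφ_xx _ (ep t) x
    · intro t x; exact mul_pos (ep t) (hδ.trans_le (ha_pos _ (ep t) x))
    · intro t x; simp only [ha_per _ (ep t)]
    · intro t x; simp only [hb_per _ (ep t)]
    · intro t x; simp only [hc_per _ (ep t)]
    · intro t x; simp only [hφ_per _ (ep t)]
    · intro t x; simp only [heq _ (ep t)]; ring
    · intro t; exact hnontriv _ (ep t)
  have := hS.mono (Real.log_le_log h1 h12)
  simpa only [Real.exp_log h1, Real.exp_log (h1.trans_le h12)] using this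
end

section
/- Let φ be a nontrivial classical solution of the linear parabolic equation φₜ = a(t,x) φₓₓ + b(t,x) φₓ + c(t,x) φ on (0,∞) × ℝ, 2π-periodic in x. If t₀ > 0 is such that every zero of φ(t₀,·) is simple (i.e. φ(t₀,x) = 0 implies ∂ₓφ(t₀,x) ≠ 0), then there exists η > 0 with η < t₀ such that z(φ(t,·)) = z(φ(t₀,·)) for all t ∈ (t₀ − η, t₀ + η). In other words, the zero number can drop only at times t₀ at which φ(t₀,·) has a multiple zero. -/
open Real Set Filter

lemma zs_shift_le (g : ℝ → ℝ) (hg : Function.Periodic g (2 * Real.pi)) (p p' : ℝ) :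
    {x ∈ Set.Ico p (p + 2 * Real.pi) | g x = 0}.encard ≤
    {x ∈ Set.Ico p' (p' + 2 * Real.pi) | g x = 0}.encard := by
  have hp : (0:ℝ) < 2 * Real.pi := Real.two_pi_pos
  apply Set.encard_le_encard_of_injOn (f := toIcoMod hp p')
  · rintro x ⟨hx, hx0⟩
    refine ⟨toIcoMod_mem_Ico hp p' x, ?_⟩
    rw [toIcoMod, hg.sub_zsmul_eq]
    exact hx0
  · rintro x ⟨hx, -⟩ y ⟨hy, -⟩ hxy
    have h1 := (toIcoMod_eq_self hp).2 hx
    have h2 := (toIcoMod_eq_self hp).2 hy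
    have h3 : toIcoMod hp p (toIcoMod hp p' x) = toIcoMod hp p (toIcoMod hp p' y) :=
      congrArg _ hxy
    simpa [toIcoMod_toIcoMod, h1, h2] using h3

lemma zeroNum_shift (g : ℝ → ℝ) (hg : Function.Periodic g (2 * Real.pi)) (p : ℝ) :
    zeroNum g = {x ∈ Set.Ico p (p + 2 * Real.pi) | g x = 0}.encard := by
  have h1 := zs_shift_le g hg 0 p
  have h2 := zs_shift_le g hg p 0
  rw [zero_add] at h1 h2
  exact le_antisymm h1 h2

def ZGood (f : ℝ → ℝ → ℝ) (t₀ u v : ℝ) : Prop :=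
  ∀ᶠ t in nhds t₀, {x ∈ Set.Ico u v | f t x = 0}.encard = {x ∈ Set.Ico u v | f t₀ x = 0}.encard

lemma ZGood.trans {f : ℝ → ℝ → ℝ} {t₀ u v w : ℝ} (huv : u ≤ v) (hvw : v ≤ w)
    (h1 : ZGood f t₀ u v) (h2 : ZGood f t₀ v w) : ZGood f t₀ u w := by
  have key : ∀ t, {x ∈ Set.Ico u w | f t x = 0}.encard =
      {x ∈ Set.Ico u v | f t x = 0}.encard + {x ∈ Set.Ico v w | f t x = 0}.encard := by
    intro t
    rw [← Set.encard_union_eq]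
    · congr 1
      ext x
      simp only [Set.mem_ofPred_eq, Set.mem_union, Set.mem_Ico]
      grind
    · rw [Set.disjoint_left]
      rintro x ⟨hx, -⟩ ⟨hx', -⟩
      exact absurd hx.2 (not_lt.2 hx'.1)
  filter_upwards [h1, h2] with t ht1 ht2
  rw [key, key, ht1, ht2]

lemma enc_empty_left {g : ℝ → ℝ} {u v : ℝ} (hg : StrictMonoOn g (Set.Icc u v)) (hu : 0 < g u) :
    {x ∈ Set.Ico u v | g x = 0}.encard = 0 := by
  rw [Set.encard_eq_zero, Set.eq_empty_iff_forall_notMem]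
  rintro x ⟨hx, h0⟩
  have := hg.monotoneOn (Set.left_mem_Icc.2 (hx.1.trans hx.2.le)) ⟨hx.1, hx.2.le⟩ hx.1
  linarith

lemma enc_empty_right {g : ℝ → ℝ} {u v : ℝ} (hg : StrictMonoOn g (Set.Icc u v)) (hu : g v < 0) :
    {x ∈ Set.Ico u v | g x = 0}.encard = 0 := by
  rw [Set.encard_eq_zero, Set.eq_empty_iff_forall_notMem]
  rintro x ⟨hx, h0⟩
  have := hg.monotoneOn ⟨hx.1, hx.2.le⟩ (Set.right_mem_Icc.2 (hx.1.trans hx.2.le)) hx.2.le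
  linarith

lemma enc_one {g : ℝ → ℝ} {u v : ℝ} (huv : u ≤ v) (hg : StrictMonoOn g (Set.Icc u v))
    (hc : ContinuousOn g (Set.Icc u v)) (hu : g u < 0) (hv : 0 < g v) :
    {x ∈ Set.Ico u v | g x = 0}.encard = 1 := by
  obtain ⟨z, hz, hz0⟩ := intermediate_value_Icc huv hc ⟨hu.le, hv.le⟩
  rw [Set.encard_eq_one]
  refine ⟨z, ?_⟩
  ext x
  simp only [Set.mem_ofPred_eq, Set.mem_singleton_iff]
  constructor
  · rintro ⟨hx, h0⟩
    exact hg.injOn ⟨hx.1, hx.2.le⟩ hz (h0.trans hz0.symm)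
  · rintro rfl
    refine ⟨⟨hz.1, lt_of_le_of_ne hz.2 ?_⟩, hz0⟩
    rintro rfl
    linarith

lemma local_pos (f fx : ℝ → ℝ → ℝ) (t₀ : ℝ) (ht₀ : 0 < t₀)
    (hfc : ∀ x, ContinuousAt (fun s => f s x) t₀)
    (hfxc : ∀ x, ContinuousAt (fun p : ℝ × ℝ => fx p.1 p.2) (t₀, x))
    (hd : ∀ t > (0:ℝ), ∀ x : ℝ, HasDerivAt (fun y => f t y) (fx t x) x)
    (x₀ : ℝ) (hpos : 0 < fx t₀ x₀) :
    ∃ ε > 0, ∀ u ∈ Set.Ioo (x₀ - ε) (x₀ + ε), ∀ v ∈ Set.Ioo (x₀ - ε) (x₀ + ε), u ≤ v →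
      f t₀ u ≠ 0 → f t₀ v ≠ 0 → ZGood f t₀ u v := by
  have h := (hfxc x₀).eventually_const_lt hpos
  obtain ⟨ε, hε, H⟩ := Metric.eventually_nhds_iff.1 h
  refine ⟨ε, hε, fun u hu v hv huv hu0 hv0 => ?_⟩
  have hmono : ∀ᶠ t in nhds t₀, StrictMonoOn (f t) (Set.Icc u v) ∧
      ContinuousOn (f t) (Set.Icc u v) := by
    filter_upwards [Metric.ball_mem_nhds t₀ hε, lt_mem_nhds ht₀] with t ht ht0
    have hcont : ContinuousOn (f t) (Set.Icc u v) :=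
      fun x _ => (hd t ht0 x).continuousAt.continuousWithinAt
    refine ⟨strictMonoOn_of_deriv_pos (convex_Icc u v) hcont ?_, hcont⟩
    intro x hx
    have hx' := interior_subset hx
    have h1 : deriv (f t) x = fx t x := (hd t ht0 x).deriv
    rw [h1]
    apply @H (t, x)
    rw [Prod.dist_eq]
    refine max_lt ht ?_
    rw [Real.dist_eq, abs_lt]
    constructor <;> linarith [hx'.1, hx'.2, hu.1, hv.2]
  have hself := hmono.self_of_nhds
  rcases lt_or_gt_of_ne hu0 with hu1 | hu1
  · rcases lt_or_gt_of_ne hv0 with hv1 | hv1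
    · filter_upwards [hmono, (hfc v).eventually_lt_const hv1] with t ht htv
      rw [enc_empty_right ht.1 htv, enc_empty_right hself.1 hv1]
    · filter_upwards [hmono, (hfc v).eventually_const_lt hv1,
        (hfc u).eventually_lt_const hu1] with t ht htv htu
      rw [enc_one huv ht.1 ht.2 htu htv, enc_one huv hself.1 hself.2 hu1 hv1]
  · filter_upwards [hmono, (hfc u).eventually_const_lt hu1] with t ht htu
    rw [enc_empty_left ht.1 htu, enc_empty_left hself.1 hu1]

lemma local_all (f fx : ℝ → ℝ → ℝ) (t₀ : ℝ) (ht₀ : 0 < t₀)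
    (hf : ∀ x, ContinuousAt (fun p : ℝ × ℝ => f p.1 p.2) (t₀, x))
    (hfxc : ∀ x, ContinuousAt (fun p : ℝ × ℝ => fx p.1 p.2) (t₀, x))
    (hfc : ∀ x, ContinuousAt (fun s => f s x) t₀)
    (hd : ∀ t > (0:ℝ), ∀ x : ℝ, HasDerivAt (fun y => f t y) (fx t x) x)
    (x₀ : ℝ) (hs : f t₀ x₀ = 0 → fx t₀ x₀ ≠ 0) :
    ∃ ε > 0, ∀ u ∈ Set.Ioo (x₀ - ε) (x₀ + ε), ∀ v ∈ Set.Ioo (x₀ - ε) (x₀ + ε), u ≤ v →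
      f t₀ u ≠ 0 → f t₀ v ≠ 0 → ZGood f t₀ u v := by
  by_cases h0 : f t₀ x₀ = 0
  · rcases lt_or_gt_of_ne (hs h0) with h1 | h1
    · obtain ⟨ε, hε, H⟩ := local_pos (fun t x => - f t x) (fun t x => - fx t x) t₀ ht₀
        (fun x => (hfc x).neg) (fun x => (hfxc x).neg) (fun t ht x => (hd t ht x).neg) x₀
        (by simpa using h1)
      refine ⟨ε, hε, fun u hu v hv huv hu0 hv0 => ?_⟩
      have := H u hu v hv huv (by simpa using hu0) (by simpa using hv0)
      simpa only [ZGood, neg_eq_zero] using this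
    · exact local_pos f fx t₀ ht₀ hfc hfxc hd x₀ h1
  · obtain ⟨ε, hε, H⟩ := Metric.eventually_nhds_iff.1 ((hf x₀).eventually_ne h0)
    refine ⟨ε, hε, fun u hu v hv huv hu0 hv0 => ?_⟩
    have key : ∀ t, dist t t₀ < ε → {x ∈ Set.Ico u v | f t x = 0}.encard = 0 := by
      intro t ht
      rw [Set.encard_eq_zero, Set.eq_empty_iff_forall_notMem]
      rintro x ⟨hx, hx0⟩
      refine @H (t, x) ?_ hx0
      rw [Prod.dist_eq]
      refine max_lt ht ?_
      rw [Real.dist_eq, abs_lt]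
      constructor <;> linarith [hx.1, hx.2, hu.1, hv.2]
    filter_upwards [Metric.ball_mem_nhds t₀ hε] with t ht
    rw [key t ht, key t₀ (by simpa using hε)]

lemma global_good (f fx : ℝ → ℝ → ℝ) (t₀ : ℝ) (ht₀ : 0 < t₀)
    (hf : ∀ x, ContinuousAt (fun p : ℝ × ℝ => f p.1 p.2) (t₀, x))
    (hfxc : ∀ x, ContinuousAt (fun p : ℝ × ℝ => fx p.1 p.2) (t₀, x))
    (hfc : ∀ x, ContinuousAt (fun s => f s x) t₀)
    (hd : ∀ t > (0:ℝ), ∀ x : ℝ, HasDerivAt (fun y => f t y) (fx t x) x)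
    (hs : ∀ x, f t₀ x = 0 → fx t₀ x ≠ 0) (p q : ℝ) (hpq : p ≤ q)
    (hp : f t₀ p ≠ 0) (hq : f t₀ q ≠ 0) : ZGood f t₀ p q := by
  choose ε hε H using fun x => local_all f fx t₀ ht₀ hf hfxc hfc hd x (hs x)
  obtain ⟨τ, hτ0, hτm, ⟨N, hN⟩, hτc⟩ := exists_monotone_Icc_subset_open_cover_Icc hpq
    (c := fun x : ℝ => (Subtype.val : Set.Icc p q → ℝ) ⁻¹' Set.Ioo (x - ε x) (x + ε x))
    (fun x => isOpen_Ioo.preimage continuous_subtype_val)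
    (fun x _ => Set.mem_iUnion.2 ⟨(x : ℝ), by constructor <;> linarith [hε (x : ℝ)]⟩)
  have R : ∀ n, ∀ v : ℝ, p ≤ v → v ≤ τ n → f t₀ v ≠ 0 → ZGood f t₀ p v := by
    intro n
    induction n with
    | zero =>
      intro v h1 h2 _
      have : v = p := le_antisymm (by rwa [hτ0] at h2) h1
      subst this
      simp [ZGood]
    | succ n ih =>
      intro v h1 h2 hv
      rcases le_total v (τ n) with h3 | h3
      · exact ih v h1 h3 hv
      obtain ⟨x, hx⟩ := hτc n
      have hvx : v ∈ Set.Ioo (x - ε x) (x + ε x) := 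
        @hx ⟨v, h1, h2.trans (τ (n+1)).2.2⟩ ⟨h3, h2⟩
      have hnx : ((τ n : ℝ)) ∈ Set.Ioo (x - ε x) (x + ε x) := 
        @hx (τ n) ⟨le_rfl, h3.trans h2⟩
      have hpn : p ≤ τ n := (τ n).2.1
      by_cases hz : f t₀ (τ n) = 0
      · have hlt : p < τ n := lt_of_le_of_ne hpn (fun h => hp (by rw [h]; exact hz))
        have e1 : ∀ᶠ w in nhdsWithin (τ n : ℝ) (Set.Iio (τ n : ℝ)), f t₀ w ≠ 0 :=
          ((hd t₀ ht₀ (τ n)).eventually_ne (hs _ hz)).filter_mono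
            (nhdsWithin_mono _ (fun y hy => ne_of_lt hy))
        have e2 : ∀ᶠ w in nhdsWithin (τ n : ℝ) (Set.Iio (τ n : ℝ)),
            w ∈ Set.Ioo (x - ε x) (x + ε x) :=
          nhdsWithin_le_nhds (isOpen_Ioo.mem_nhds hnx)
        have e3 : ∀ᶠ w in nhdsWithin (τ n : ℝ) (Set.Iio (τ n : ℝ)), p < w :=
          nhdsWithin_le_nhds (lt_mem_nhds hlt)
        obtain ⟨w, ⟨⟨w1, w2⟩, w3⟩, w4⟩ := (((e1.and e2).and e3).and self_mem_nhdsWithin).exists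
        have w4' : w < τ n := w4
        exact (ih w w3.le w4'.le w1).trans w3.le (w4'.le.trans h3)
          (H x w w2 v hvx (w4'.le.trans h3) w1 hv)
      · exact (ih _ hpn le_rfl hz).trans hpn h3 (H x _ hnx v hvx h3 hz hv)
  exact R N q hpq (by rw [hN N le_rfl]) hq

theorem stmt2
    (δ : ℝ) (hδ : 0 < δ)
    (a b c a_t a_x : ℝ → ℝ → ℝ)
    (φ φ_t φ_x φ_xx : ℝ → ℝ → ℝ)
    (ha_cont : ContinuousOn (fun p : ℝ × ℝ => a p.1 p.2) (Set.Ioi 0 ×ˢ Set.univ))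
    (hb_cont : ContinuousOn (fun p : ℝ × ℝ => b p.1 p.2) (Set.Ioi 0 ×ˢ Set.univ))
    (hc_cont : ContinuousOn (fun p : ℝ × ℝ => c p.1 p.2) (Set.Ioi 0 ×ˢ Set.univ))
    (hat_cont : ContinuousOn (fun p : ℝ × ℝ => a_t p.1 p.2) (Set.Ioi 0 ×ˢ Set.univ))
    (hax_cont : ContinuousOn (fun p : ℝ × ℝ => a_x p.1 p.2) (Set.Ioi 0 ×ˢ Set.univ))
    (ha_t : ∀ t > (0:ℝ), ∀ x : ℝ, HasDerivAt (fun s => a s x) (a_t t x) t)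
    (ha_x : ∀ t > (0:ℝ), ∀ x : ℝ, HasDerivAt (fun y => a t y) (a_x t x) x)
    (M : ℝ)
    (hbound : ∀ t > (0:ℝ), ∀ x : ℝ,
      |a t x| ≤ M ∧ |a_t t x| ≤ M ∧ |a_x t x| ≤ M ∧ |b t x| ≤ M ∧ |c t x| ≤ M)
    (ha_pos : ∀ t > (0:ℝ), ∀ x : ℝ, δ ≤ a t x)
    (ha_per : ∀ t > (0:ℝ), ∀ x : ℝ, a t (x + 2 * Real.pi) = a t x)
    (hb_per : ∀ t > (0:ℝ), ∀ x : ℝ, b t (x + 2 * Real.pi) = b t x)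
    (hc_per : ∀ t > (0:ℝ), ∀ x : ℝ, c t (x + 2 * Real.pi) = c t x)
    (hφ_per : ∀ t > (0:ℝ), ∀ x : ℝ, φ t (x + 2 * Real.pi) = φ t x)
    (hφ_cont : ContinuousOn (fun p : ℝ × ℝ => φ p.1 p.2) (Set.Ioi 0 ×ˢ Set.univ))
    (hφt_cont : ContinuousOn (fun p : ℝ × ℝ => φ_t p.1 p.2) (Set.Ioi 0 ×ˢ Set.univ))
    (hφx_cont : ContinuousOn (fun p : ℝ × ℝ => φ_x p.1 p.2) (Set.Ioi 0 ×ˢ Set.univ))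
    (hφxx_cont : ContinuousOn (fun p : ℝ × ℝ => φ_xx p.1 p.2) (Set.Ioi 0 ×ˢ Set.univ))
    (hφ_t : ∀ t > (0:ℝ), ∀ x : ℝ, HasDerivAt (fun s => φ s x) (φ_t t x) t)
    (hφ_x : ∀ t > (0:ℝ), ∀ x : ℝ, HasDerivAt (fun y => φ t y) (φ_x t x) x)
    (hφ_xx : ∀ t > (0:ℝ), ∀ x : ℝ, HasDerivAt (fun y => φ_x t y) (φ_xx t x) x)
    (heq : ∀ t > (0:ℝ), ∀ x : ℝ,
      φ_t t x = a t x * φ_xx t x + b t x * φ_x t x + c t x * φ t x)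
    (hnontriv : ∀ t > (0:ℝ), ∃ x : ℝ, φ t x ≠ 0)
    (t₀ : ℝ) (ht₀ : 0 < t₀)
    (hsimple : ∀ x : ℝ, φ t₀ x = 0 → φ_x t₀ x ≠ 0) :
    ∃ η > (0:ℝ), η < t₀ ∧
      ∀ t : ℝ, t₀ - η < t → t < t₀ + η → zeroNum (φ t) = zeroNum (φ t₀) := by
  have hmem : ∀ x : ℝ, Set.Ioi (0:ℝ) ×ˢ (Set.univ : Set ℝ) ∈ nhds (t₀, x) := fun x =>
    (isOpen_Ioi.prod isOpen_univ).mem_nhds ⟨ht₀, Set.mem_univ _⟩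
  obtain ⟨p, hp⟩ := hnontriv t₀ ht₀
  have hg := global_good φ φ_x t₀ ht₀ (fun x => hφ_cont.continuousAt (hmem x))
    (fun x => hφx_cont.continuousAt (hmem x)) (fun x => (hφ_t t₀ ht₀ x).continuousAt) hφ_x hsimple
    p (p + 2 * Real.pi) (by linarith [Real.two_pi_pos]) hp (by rwa [hφ_per t₀ ht₀])
  obtain ⟨ε, hε, H⟩ := Metric.eventually_nhds_iff.1 hg
  refine ⟨min ε (t₀ / 2), by positivity, (min_le_right _ _).trans_lt (by linarith), ?_⟩
  intro t h1 h2
  have m1 := min_le_left ε (t₀ / 2)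
  have m2 := min_le_right ε (t₀ / 2)
  rw [zeroNum_shift (φ t) (hφ_per t (by linarith)) p, zeroNum_shift (φ t₀) (hφ_per t₀ ht₀) p]
  apply H
  rw [Real.dist_eq, abs_lt]
  constructor <;> linarith
end
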